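/- arXiv:1702.00929 — 4 statements merged into one kernel-verified Lean document; each statement's English description precedes it below -/
import Mathlib

section
/- Let n > 2 be an integer, let x be a point of the open unit ball B^n ⊂ ℝ^n, let z ∈ B^n with z ≠ 0, and set y = T_{−x} z = ((1−|x|²)(z+x) + x|z+x|²)/[z,−x]². Then | (x−y)/|x−y|^n − (|y|²x − y)/[x,y]^n | = ([z,−x]^{n−2} / ((1−|x|²)^{n−1} |z|^{n−1})) · | |z|^{n−1}(z+x) − x|z| − z/|z| |. -/
open Real
open scoped RealInnerProductSpace

/-- `[x,y] := (|x|²|y|² − 2⟨x,y⟩ + 1)^{1/2}`. -/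
noncomputable def mobiusBracket {n : ℕ} (x y : EuclideanSpace ℝ (Fin n)) : ℝ :=
  Real.sqrt (‖x‖ ^ 2 * ‖y‖ ^ 2 - 2 * ⟪x, y⟫ + 1)

/-- The kernel `(x−y)/|x−y|^n − (|y|²x − y)/[x,y]^n`. -/
noncomputable def poissonGradKer (n : ℕ) (x y : EuclideanSpace ℝ (Fin n)) :
    EuclideanSpace ℝ (Fin n) :=
  (‖x - y‖ ^ n)⁻¹ • (x - y) - (mobiusBracket x y ^ n)⁻¹ • (‖y‖ ^ 2 • x - y)

section

variable {n : ℕ} {x z : EuclideanSpace ℝ (Fin n)}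

lemma mobiusBracket_neg_radicand_pos (hx : ‖x‖ < 1) (hz : ‖z‖ < 1) :
    0 < ‖x‖ ^ 2 * ‖z‖ ^ 2 + 2 * ⟪x, z⟫ + 1 := by
  have hxz : ‖x‖ * ‖z‖ < 1 := mul_lt_one_of_nonneg_of_lt_one_left (norm_nonneg x) hx hz.le
  have hinner := neg_le_of_abs_le (abs_real_inner_le_norm x z)
  nlinarith [mul_pos (sub_pos.2 hxz) (sub_pos.2 hxz)]

lemma mobiusBracket_neg_pos (hx : ‖x‖ < 1) (hz : ‖z‖ < 1) :
    0 < mobiusBracket z (-x) := by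
  rw [mobiusBracket, Real.sqrt_pos, norm_neg, inner_neg_right, real_inner_comm]
  linarith [mobiusBracket_neg_radicand_pos hx hz]

lemma mobiusBracket_neg_sq (hx : ‖x‖ < 1) (hz : ‖z‖ < 1) :
    mobiusBracket z (-x) ^ 2 = ‖x‖ ^ 2 * ‖z‖ ^ 2 + 2 * ⟪x, z⟫ + 1 := by
  have h := mobiusBracket_neg_radicand_pos hx hz
  rw [mobiusBracket, norm_neg, inner_neg_right, real_inner_comm, Real.sq_sqrt (by linarith)]
  ring

/-- The image `T_{−x} z` of `z` under the Möbius transformation of the ball sending `0` to `x`. -/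
noncomputable def mobiusImage (x z : EuclideanSpace ℝ (Fin n)) :
    EuclideanSpace ℝ (Fin n) :=
  (mobiusBracket z (-x) ^ 2)⁻¹ • ((1 - ‖x‖ ^ 2) • (z + x) + ‖z + x‖ ^ 2 • x)

lemma sub_mobiusImage (hx : ‖x‖ < 1) (hz : ‖z‖ < 1) :
    x - mobiusImage x z =
      -((1 - ‖x‖ ^ 2) / mobiusBracket z (-x) ^ 2) • (‖z‖ ^ 2 • x + z) := by
  have hB := mobiusBracket_neg_sq hx hz
  have hb := (mobiusBracket_neg_pos hx hz).ne'
  rw [mobiusImage, norm_add_sq_real, real_inner_comm]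
  match_scalars
  · field_simp
    rw [hB]
    ring
  · field_simp

lemma norm_sub_mobiusImage (hx : ‖x‖ < 1) (hz : ‖z‖ < 1) :
    ‖x - mobiusImage x z‖ = (1 - ‖x‖ ^ 2) * ‖z‖ / mobiusBracket z (-x) := by
  have hb := mobiusBracket_neg_pos hx hz
  have hs : 0 < 1 - ‖x‖ ^ 2 := by nlinarith [norm_nonneg x]
  have h : ‖‖z‖ ^ 2 • x + z‖ = ‖z‖ * mobiusBracket z (-x) := by
    rw [← sq_eq_sq₀ (norm_nonneg _) (by positivity), mul_pow, mobiusBracket_neg_sq hx hz,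
      norm_add_sq_real, norm_smul, real_inner_smul_left, Real.norm_of_nonneg (by positivity)]
    ring
  rw [sub_mobiusImage hx hz, norm_smul, norm_neg, Real.norm_of_nonneg (by positivity), h]
  field_simp

lemma norm_mobiusImage_sq (hx : ‖x‖ < 1) (hz : ‖z‖ < 1) :
    ‖mobiusImage x z‖ ^ 2 = ‖z + x‖ ^ 2 / mobiusBracket z (-x) ^ 2 := by
  have hB := mobiusBracket_neg_sq hx hz
  have hb := mobiusBracket_neg_pos hx hz
  have h : ‖(1 - ‖x‖ ^ 2) • (z + x) + ‖z + x‖ ^ 2 • x‖ ^ 2 =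
      ‖z + x‖ ^ 2 * mobiusBracket z (-x) ^ 2 := by
    rw [hB, norm_add_sq_real, norm_smul, norm_smul, real_inner_smul_left, real_inner_smul_right,
      mul_pow, mul_pow, Real.norm_eq_abs, sq_abs, Real.norm_eq_abs, sq_abs, inner_add_left,
      norm_add_sq_real, real_inner_self_eq_norm_sq, real_inner_comm]
    ring
  rw [mobiusImage, norm_smul, mul_pow, h, norm_inv, inv_pow, Real.norm_of_nonneg (by positivity)]
  field_simp

lemma norm_sq_smul_sub_mobiusImage (hx : ‖x‖ < 1) (hz : ‖z‖ < 1) :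
    ‖mobiusImage x z‖ ^ 2 • x - mobiusImage x z =
      -((1 - ‖x‖ ^ 2) / mobiusBracket z (-x) ^ 2) • (z + x) := by
  rw [norm_mobiusImage_sq hx hz, mobiusImage]
  match_scalars <;> ring

lemma mobiusBracket_mobiusImage (hx : ‖x‖ < 1) (hz : ‖z‖ < 1) :
    mobiusBracket x (mobiusImage x z) = (1 - ‖x‖ ^ 2) / mobiusBracket z (-x) := by
  have hB := mobiusBracket_neg_sq hx hz
  have hb := mobiusBracket_neg_pos hx hz
  have hs : 0 < 1 - ‖x‖ ^ 2 := by nlinarith [norm_nonneg x]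
  have hdist := congrArg (· ^ 2) (norm_sub_mobiusImage hx hz)
  simp only [norm_sub_sq_real] at hdist
  have h : ‖x‖ ^ 2 * ‖mobiusImage x z‖ ^ 2 - 2 * ⟪x, mobiusImage x z⟫ + 1 =
      ((1 - ‖x‖ ^ 2) / mobiusBracket z (-x)) ^ 2 := by
    have hsplit : ‖x‖ ^ 2 * ‖mobiusImage x z‖ ^ 2 - 2 * ⟪x, mobiusImage x z⟫ + 1 =
        ((1 - ‖x‖ ^ 2) * ‖z‖ / mobiusBracket z (-x)) ^ 2 +
          (1 - ‖x‖ ^ 2) * (1 - ‖mobiusImage x z‖ ^ 2) := by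
      rw [← hdist]
      ring
    rw [hsplit, norm_mobiusImage_sq hx hz, norm_add_sq_real, real_inner_comm]
    field_simp
    rw [hB]
    ring
  rw [mobiusBracket, h, Real.sqrt_sq (by positivity)]

lemma poissonGradKer_mobiusImage (hn : 2 ≤ n) (hx : ‖x‖ < 1) (hz : ‖z‖ < 1)
    (hz0 : z ≠ 0) :
    poissonGradKer n x (mobiusImage x z) =
      (mobiusBracket z (-x) ^ (n - 2) / ((1 - ‖x‖ ^ 2) ^ (n - 1) * ‖z‖ ^ (n - 1))) •
        (‖z‖ ^ (n - 1) • (z + x) - ‖z‖ • x - ‖z‖⁻¹ • z) := by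
  have hb := (mobiusBracket_neg_pos hx hz).ne'
  have hs : 1 - ‖x‖ ^ 2 ≠ 0 := by nlinarith [norm_nonneg x]
  have hr : ‖z‖ ≠ 0 := norm_ne_zero_iff.2 hz0
  rw [poissonGradKer, mobiusBracket_mobiusImage hx hz, norm_sub_mobiusImage hx hz,
    norm_sq_smul_sub_mobiusImage hx hz, sub_mobiusImage hx hz]
  generalize mobiusBracket z (-x) = b at hb ⊢
  generalize 1 - ‖x‖ ^ 2 = s at hs ⊢
  generalize ‖z‖ = r at hr ⊢
  have hpow (a : ℝ) : a ^ n = a ^ (n - 2) * a ^ 2 := by rw [← pow_add, Nat.sub_add_cancel hn]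
  have hpow' (a : ℝ) : a ^ (n - 1) = a ^ (n - 2) * a := by rw [← pow_succ]; congr 1; omega
  have hbk := pow_ne_zero (n - 2) hb
  have hsk := pow_ne_zero (n - 2) hs
  have hrk := pow_ne_zero (n - 2) hr
  simp only [hpow, hpow', div_pow, mul_pow]
  generalize b ^ (n - 2) = bk at hbk ⊢
  generalize s ^ (n - 2) = sk at hsk ⊢
  generalize r ^ (n - 2) = rk at hrk ⊢
  match_scalars <;> field_simp <;> ring

end

/-- Substituting `y = T_{−x} z` in the kernel of the gradient of the Green potential:
`|(x−y)/|x−y|^n − (|y|²x−y)/[x,y]^n|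
   = [z,−x]^{n−2}/((1−|x|²)^{n−1}|z|^{n−1}) · | |z|^{n−1}(z+x) − x|z| − z/|z| |`. -/
theorem norm_ker_mobius_substitution (n : ℕ) (hn : 2 < n) (x z : EuclideanSpace ℝ (Fin n))
    (hx : x ∈ Metric.ball (0 : EuclideanSpace ℝ (Fin n)) 1)
    (hz : z ∈ Metric.ball (0 : EuclideanSpace ℝ (Fin n)) 1) (hz0 : z ≠ 0)
    (y : EuclideanSpace ℝ (Fin n))
    (hy : y = (mobiusBracket z (-x) ^ 2)⁻¹ • ((1 - ‖x‖ ^ 2) • (z + x) + ‖z + x‖ ^ 2 • x)) :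
    ‖poissonGradKer n x y‖ =
      mobiusBracket z (-x) ^ (n - 2) / ((1 - ‖x‖ ^ 2) ^ (n - 1) * ‖z‖ ^ (n - 1)) *
        ‖(‖z‖ ^ (n - 1)) • (z + x) - ‖z‖ • x - ‖z‖⁻¹ • z‖ := by
  rw [mem_ball_zero_iff] at hx hz
  have hs : 0 < 1 - ‖x‖ ^ 2 := by nlinarith [norm_nonneg x]
  have hb := mobiusBracket_neg_pos hx hz
  rw [show y = mobiusImage x z from hy, poissonGradKer_mobiusImage hn.le hx hz hz0, norm_smul,
    Real.norm_of_nonneg (by positivity)]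
end

section
/- Let n ≥ 2 be an integer, let a > 0, and let w ∈ ℝ^n with |w| < 1. Then ∫_{S^{n−1}} |w + ξ|^{−a} dσ(ξ) = (2π^{n/2}/Γ(n/2)) · F(a/2, a/2 + 1 − n/2; n/2; |w|²), where dσ is the (unnormalized) surface measure on the unit sphere S^{n−1} and F is the Gauss hypergeometric function. -/
open Real MeasureTheory

/-- The Gauss hypergeometric function `F(a,b;c;t) = Σ_{k≥0} (a)_k (b)_k / ((c)_k k!) t^k`. -/
noncomputable def gaussHypergeometric (a b c t : ℝ) : ℝ :=
  ∑' k : ℕ, ((ascPochhammer ℝ k).eval a * (ascPochhammer ℝ k).eval b) /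
    ((ascPochhammer ℝ k).eval c * (Nat.factorial k)) * t ^ k

theorem hasSum_one_sub_rpow_neg (a : ℝ) {x : ℝ} (hx : |x| < 1) :
    HasSum (fun k : ℕ => (ascPochhammer ℝ k).eval a / k.factorial * x ^ k) ((1 - x) ^ (-a)) := by
  have h := (Real.one_div_one_sub_rpow_hasFPowerSeriesOnBall_zero a).hasSum (y := x)
    (by simpa [enorm_eq_nnnorm, ← NNReal.coe_lt_coe] using hx)
  rw [zero_add, one_div, ← Real.rpow_neg (by linarith [(abs_lt.mp hx).2])] at h
  convert! h using 2 with k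
  rw [FormalMultilinearSeries.ofScalars_apply_eq, smul_eq_mul, ← Ring.multichoose_eq,
    div_mul_eq_mul_div, div_eq_iff (by positivity)]
  have := Ring.factorial_nsmul_multichoose_eq_ascPochhammer a k
  rw [Polynomial.ascPochhammer_smeval_eq_eval, nsmul_eq_mul] at this
  rw [← this]; ring

theorem summable_abs_mul_pow_of_ratio {c ρ : ℕ → ℝ} {L x : ℝ} (hc : ∀ k, c (k + 1) = ρ k * c k)
    (hρ : Filter.Tendsto ρ Filter.atTop (nhds L)) (hx : |L * x| < 1) :
    Summable fun k => |c k * x ^ k| := by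
  obtain ⟨r, hr, hr1⟩ := exists_between hx
  refine summable_of_ratio_norm_eventually_le (r := r) hr1 ?_
  filter_upwards [((hρ.mul_const x).abs).eventually (gt_mem_nhds hr)] with k hk
  rw [Real.norm_eq_abs, Real.norm_eq_abs, abs_abs, abs_abs, hc,
    show ρ k * c k * x ^ (k + 1) = ρ k * x * (c k * x ^ k) by ring, abs_mul]
  gcongr

theorem analyticOnNhd_tsum_mul_pow {c : ℕ → ℝ} {R : ℝ}
    (h : ∀ x, |x| < R → Summable fun k => |c k * x ^ k|) :
    AnalyticOnNhd ℝ (fun x => ∑' k, c k * x ^ k) (Metric.ball 0 R) := by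
  intro x hx
  have hx' : |x| < R := by simpa using hx
  obtain ⟨r, hr, hrR⟩ := exists_between hx'
  have hr0 : 0 < r := (abs_nonneg x).trans_lt hr
  set p := FormalMultilinearSeries.ofScalars ℝ c
  have hrad : ENNReal.ofReal r ≤ p.radius := by
    refine p.le_radius_of_summable_norm (r := r.toNNReal) ?_
    refine (h r (by rwa [abs_of_pos hr0])).congr fun k => ?_
    rw [FormalMultilinearSeries.ofScalars_norm, Real.coe_toNNReal _ hr0.le, abs_mul, abs_pow,
      abs_of_pos hr0, Real.norm_eq_abs]
  have hp : 0 < p.radius := lt_of_lt_of_le (by simpa using hr0) hrad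
  have hf : HasFPowerSeriesOnBall (fun x => ∑' k, c k * x ^ k) p 0 p.radius := by
    convert p.hasFPowerSeriesOnBall hp using 1
    funext y
    simp [FormalMultilinearSeries.sum, p, mul_comm]
  refine hf.analyticOnNhd x ?_
  refine lt_of_lt_of_le ?_ hrad
  rw [edist_zero_right, ← ofReal_norm]
  exact (ENNReal.ofReal_lt_ofReal_iff hr0).mpr hr

theorem ascPochhammer_eval_add (a : ℝ) (j m : ℕ) :
    (ascPochhammer ℝ (j + m)).eval a =
      (ascPochhammer ℝ j).eval a * (ascPochhammer ℝ m).eval (a + j) := by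
  rw [← ascPochhammer_mul]
  simp

/-- Vandermonde's identity for falling factorials. -/
theorem descPochhammer_eval_add (r s : ℝ) (k : ℕ) :
    (descPochhammer ℝ k).eval (r + s) = ∑ ij ∈ Finset.HasAntidiagonal.antidiagonal k,
      (k.choose ij.1 : ℝ) * ((descPochhammer ℝ ij.1).eval r * (descPochhammer ℝ ij.2).eval s) := by
  have key (x : ℝ) (i : ℕ) : (descPochhammer ℤ i).smeval x = (descPochhammer ℝ i).eval x := by
    rw [Polynomial.descPochhammer_smeval_eq_ascPochhammer, Polynomial.ascPochhammer_smeval_eq_eval,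
      descPochhammer_eval_eq_ascPochhammer]
  simpa only [key] using Ring.descPochhammer_smeval_add (r := r) (s := s) k (Commute.all _ _)

/-- A form of the Chu–Vandermonde summation formula. -/
theorem sum_antidiagonal_ascPochhammer (A : ℝ) {C : ℝ} (hC : 0 < C) (k : ℕ) :
    ∑ p ∈ Finset.HasAntidiagonal.antidiagonal k,
      (-1) ^ p.2 * (ascPochhammer ℝ (2 * p.1 + p.2)).eval A /
      ((ascPochhammer ℝ p.1).eval C * p.1.factorial * p.2.factorial) =
    (ascPochhammer ℝ k).eval A * (ascPochhammer ℝ k).eval (A + 1 - C) /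
      ((ascPochhammer ℝ k).eval C * k.factorial) := by
  have hP (j : ℕ) : (ascPochhammer ℝ j).eval C ≠ 0 := (ascPochhammer_pos j C hC).ne'
  have h := descPochhammer_eval_add (-A - k) (C + k - 1) k
  have hl : (ascPochhammer ℝ k).eval (A + 1 - C) =
      (-1) ^ k * (descPochhammer ℝ k).eval (-A - k + (C + k - 1)) := by
    rw [← ascPochhammer_eval_neg_eq_descPochhammer]
    ring_nf
  rw [hl, h, Finset.mul_sum, Finset.mul_sum, Finset.sum_div]
  refine Finset.sum_congr rfl fun p hp => ?_
  obtain ⟨j, m⟩ := p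
  rw [Finset.HasAntidiagonal.mem_antidiagonal] at hp
  simp only at hp ⊢
  subst hp
  have h1 : (ascPochhammer ℝ (2 * j + m)).eval A = (ascPochhammer ℝ (j + m)).eval A *
      ((-1) ^ j * (descPochhammer ℝ j).eval (-A - (j + m : ℕ))) := by
    rw [← ascPochhammer_eval_neg_eq_descPochhammer, show 2 * j + m = (j + m) + j by ring,
      ascPochhammer_eval_add]
    congr 2
    ring
  have h2 : (ascPochhammer ℝ (j + m)).eval C = (ascPochhammer ℝ j).eval C *
      (descPochhammer ℝ m).eval (C + (j + m : ℕ) - 1) := by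
    rw [ascPochhammer_eval_add, descPochhammer_eval_eq_ascPochhammer]
    congr 2
    push_cast; ring
  have h3 : (descPochhammer ℝ m).eval (C + (j + m : ℕ) - 1) ≠ 0 := by
    intro h0
    exact hP (j + m) (by rw [h2, h0, mul_zero])
  have h4 : ((j + m).choose j : ℝ) * j.factorial * m.factorial = (j + m).factorial := by
    have := Nat.choose_mul_factorial_mul_factorial (Nat.le_add_right j m)
    rw [Nat.add_sub_cancel_left] at this
    exact_mod_cast this
  have h5 : ((j + m).choose j : ℝ) ≠ 0 := by
    exact_mod_cast (Nat.choose_pos (Nat.le_add_right j m)).ne'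
  rw [h1, h2, ← h4]
  have := hP j
  have h6 : ((-1 : ℝ) ^ j) ^ 2 = 1 := by rw [← pow_mul, mul_comm, pow_mul]; simp
  field_simp
  ring


theorem tendsto_add_div_add (a b : ℝ) :
    Filter.Tendsto (fun k : ℕ => (a + k) / (b + k)) Filter.atTop (nhds 1) := by
  have := tendsto_add_mul_div_add_mul_atTop_nhds a b 1 (d := (1 : ℝ)) one_ne_zero
  simpa using this

theorem summable_abs_gaussHypergeometric (a b : ℝ) {c x : ℝ} (hc : 0 < c) (hx : |x| < 1) :
    Summable fun k : ℕ => |((ascPochhammer ℝ k).eval a * (ascPochhammer ℝ k).eval b) /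
      ((ascPochhammer ℝ k).eval c * (Nat.factorial k)) * x ^ k| := by
  refine summable_abs_mul_pow_of_ratio
    (ρ := fun k : ℕ => ((a + k) / (c + k)) * ((b + k) / (1 + k))) (L := 1 * 1) (fun k => ?_)
    ((tendsto_add_div_add a c).mul (tendsto_add_div_add b 1)) (by simpa using hx)
  have := (ascPochhammer_pos k c hc).ne'
  have : c + k ≠ 0 := by positivity
  rw [ascPochhammer_succ_eval, ascPochhammer_succ_eval, ascPochhammer_succ_eval,
    Nat.factorial_succ]
  push_cast
  field_simp
  ring

theorem summable_abs_quadratic (A : ℝ) {C x : ℝ} (hC : 0 < C) (hx : |x| < 1 / 4) :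
    Summable fun k : ℕ => |(ascPochhammer ℝ (2 * k)).eval A /
      ((ascPochhammer ℝ k).eval C * (Nat.factorial k)) * x ^ k| := by
  refine summable_abs_mul_pow_of_ratio
    (ρ := fun k : ℕ => 4 * (((A / 2 + k) / (C + k)) * (((A + 1) / 2 + k) / (1 + k))))
    (L := 4 * (1 * 1)) (fun k => ?_)
    (((tendsto_add_div_add _ C).mul (tendsto_add_div_add _ 1)).const_mul 4) ?_
  · have := (ascPochhammer_pos k C hC).ne'
    have : C + k ≠ 0 := by positivity
    rw [show 2 * (k + 1) = 2 * k + 1 + 1 by ring, ascPochhammer_succ_eval,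
      ascPochhammer_succ_eval, ascPochhammer_succ_eval, Nat.factorial_succ]
    push_cast
    field_simp
    ring
  · rw [abs_mul]
    norm_num
    linarith

/-- The quadratic transformation near `0`, where the double series obtained by expanding the powers
of `1 + z` converges absolutely. -/
theorem quadratic_transformation_of_abs_lt {A C z : ℝ} (hA : 0 < A) (hC : 0 < C)
    (hz : |z| < 1 / 10) :
    (1 + z) ^ (-A) * ∑' j : ℕ, (ascPochhammer ℝ (2 * j)).eval A /
      ((ascPochhammer ℝ j).eval C * (Nat.factorial j)) * (z / (1 + z) ^ 2) ^ j =
    gaussHypergeometric A (A + 1 - C) C z := by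
  have hP (j : ℕ) : 0 < (ascPochhammer ℝ j).eval C := ascPochhammer_pos j C hC
  have hQ (j : ℕ) : 0 < (ascPochhammer ℝ j).eval A := ascPochhammer_pos j A hA
  have hsum {x : ℝ} (hx : |x| < 1 / 10) (j : ℕ) :
      HasSum (fun m : ℕ => (-1) ^ m * (ascPochhammer ℝ (2 * j + m)).eval A /
        ((ascPochhammer ℝ j).eval C * j.factorial * m.factorial) * x ^ (j + m))
      ((1 + x) ^ (-A) * ((ascPochhammer ℝ (2 * j)).eval A /
      ((ascPochhammer ℝ j).eval C * (Nat.factorial j)) * (x / (1 + x) ^ 2) ^ j)) := by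
    have hx1 : 0 < 1 + x := by linarith [(abs_lt.mp hx).1]
    have h := (hasSum_one_sub_rpow_neg (A + (2 * j : ℕ)) (x := -x)
      (by rw [abs_neg]; linarith)).mul_left ((ascPochhammer ℝ (2 * j)).eval A /
      ((ascPochhammer ℝ j).eval C * (Nat.factorial j)) * x ^ j)
    convert! h using 1
    · funext m
      rw [ascPochhammer_eval_add, neg_pow]
      have := (hP j).ne'
      field_simp
      ring
    · rw [sub_neg_eq_add, neg_add, Real.rpow_add hx1, Real.rpow_neg hx1.le ((2 * j : ℕ) : ℝ),
        Real.rpow_natCast, div_pow, pow_mul]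
      ring
  have habs : Summable fun p : ℕ × ℕ => |(-1) ^ p.2 * (ascPochhammer ℝ (2 * p.1 + p.2)).eval A /
        ((ascPochhammer ℝ p.1).eval C * p.1.factorial * p.2.factorial) * z ^ (p.1 + p.2)| := by
    have hz' : |(-|z|)| < 1 / 10 := by rwa [abs_neg, abs_abs]
    have hs (j : ℕ) := (hsum hz' j).mul_left ((-1) ^ j)
    have heq (j m : ℕ) : |(-1) ^ m * (ascPochhammer ℝ (2 * j + m)).eval A /
        ((ascPochhammer ℝ j).eval C * j.factorial * m.factorial) * z ^ (j + m)| =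
        (-1) ^ j * ((-1) ^ m * (ascPochhammer ℝ (2 * j + m)).eval A /
        ((ascPochhammer ℝ j).eval C * j.factorial * m.factorial) * (-|z|) ^ (j + m)) := by
      have h1 : ((-1 : ℝ) ^ j) ^ 2 = 1 := by rw [← pow_mul, mul_comm, pow_mul]; simp
      have h2 : ((-1 : ℝ) ^ m) ^ 2 = 1 := by rw [← pow_mul, mul_comm, pow_mul]; simp
      rw [abs_mul, abs_div, abs_mul, abs_pow, abs_neg, abs_one, one_pow, one_mul, abs_of_pos (hQ _),
        abs_of_pos (mul_pos (mul_pos (hP j) (by positivity)) (by positivity)), abs_pow, neg_pow |z|,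
        pow_add (-1 : ℝ)]
      linear_combination (-(Polynomial.eval A (ascPochhammer ℝ (2 * j + m)) /
        (Polynomial.eval C (ascPochhammer ℝ j) * j.factorial * m.factorial) * |z| ^ (j + m))) *
        (h1 * ((-1 : ℝ) ^ m) ^ 2 + h2)
    rw [summable_prod_of_nonneg fun _ => abs_nonneg _]
    refine ⟨fun j => ?_, ?_⟩
    · simp only [heq]
      exact (hs j).summable
    · simp only [heq, (hs _).tsum_eq]
      have h3 : |(-|z| / (1 + -|z|) ^ 2)| < 1 / 4 := by
        rw [abs_div, abs_neg, abs_abs, abs_pow, sq_abs, div_lt_iff₀ (by nlinarith [abs_nonneg z])]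
        nlinarith [abs_nonneg z]
      refine ((summable_abs_quadratic A hC h3).mul_left ((1 + -|z|) ^ (-A))).congr fun j => ?_
      rw [abs_mul, abs_of_pos (div_pos (hQ _) (mul_pos (hP j) (by positivity))), abs_pow, abs_div,
        abs_neg, abs_abs, abs_pow, sq_abs, neg_div, neg_pow (|z| / _)]
      have h1 : ((-1 : ℝ) ^ j) * (-1 : ℝ) ^ j = 1 := by rw [← mul_pow]; simp
      linear_combination (-((1 + -|z|) ^ (-A) * (Polynomial.eval A (ascPochhammer ℝ (2 * j)) /
        (Polynomial.eval C (ascPochhammer ℝ j) * j.factorial) *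
          (|z| / (1 + -|z|) ^ 2) ^ j))) * h1
  have hF := habs.of_abs
  rw [← tsum_mul_left, gaussHypergeometric]
  calc _ = ∑' j, ∑' m, _ := tsum_congr fun j => (hsum hz j).tsum_eq.symm
    _ = _ := (hF.tsum_prod' fun j => (hsum hz j).summable).symm
    _ = _ := (Finset.HasAntidiagonal.sigmaAntidiagonalEquivProd (A := ℕ)).tsum_eq _ |>.symm
    _ = _ := ((Finset.HasAntidiagonal.sigmaAntidiagonalEquivProd (A := ℕ)).summable_iff.mpr
        hF).tsum_sigma' fun k => (hasSum_fintype _).summable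
    _ = _ := tsum_congr fun k => ?_
  rw [tsum_fintype, ← sum_antidiagonal_ascPochhammer A hC k, Finset.sum_mul,
    ← Finset.sum_coe_sort (Finset.HasAntidiagonal.antidiagonal k)]
  refine Finset.sum_congr rfl fun p _ => ?_
  have := Finset.HasAntidiagonal.mem_antidiagonal.mp p.2
  simp [this]

/-- A quadratic transformation of the Gauss hypergeometric function. Both sides are analytic on
`(-1/10, 1)`, so the identity extends from a neighbourhood of `0`. -/
theorem quadratic_transformation {A C z : ℝ} (hA : 0 < A) (hC : 0 < C) (hz : 0 ≤ z) (hz1 : z < 1) :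
    (1 + z) ^ (-A) * ∑' j : ℕ, (ascPochhammer ℝ (2 * j)).eval A /
      ((ascPochhammer ℝ j).eval C * (Nat.factorial j)) * (z / (1 + z) ^ 2) ^ j =
    gaussHypergeometric A (A + 1 - C) C z := by
  have hU : ∀ x ∈ Set.Ioo (-1 / 10 : ℝ) 1, |x / (1 + x) ^ 2| < 1 / 4 := by
    rintro x ⟨h1, h2⟩
    rw [abs_div, abs_pow, sq_abs, div_lt_iff₀ (by nlinarith)]
    rcases abs_cases x with ⟨h, _⟩ | ⟨h, _⟩ <;> rw [h] <;> nlinarith [sq_pos_of_pos (sub_pos.2 h2)]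
  have hf : AnalyticOnNhd ℝ (fun x : ℝ => (1 + x) ^ (-A) *
      ∑' j : ℕ, (ascPochhammer ℝ (2 * j)).eval A /
      ((ascPochhammer ℝ j).eval C * (Nat.factorial j)) * (x / (1 + x) ^ 2) ^ j)
      (Set.Ioo (-1 / 10) 1) := by
    have hd : ∀ x ∈ Set.Ioo (-1 / 10 : ℝ) 1, 0 < 1 + x := fun x hx => by linarith [hx.1]
    refine AnalyticOnNhd.mul (fun x hx => ?_) ?_
    · have hx0 := hd x hx
      refine ((AnalyticAt.log (analyticAt_const.add analyticAt_id) hx0).mul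
        (analyticAt_const (v := -A))).rexp'.congr ?_
      filter_upwards [(continuous_const.add continuous_id).continuousAt.eventually
        (lt_mem_nhds hx0)] with y hy
      exact (Real.rpow_def_of_pos hy _).symm
    · refine (analyticOnNhd_tsum_mul_pow fun x hx => summable_abs_quadratic A hC hx).comp
        (f := fun x : ℝ => x / (1 + x) ^ 2) (fun x hx => ?_) fun x hx => by
          rw [mem_ball_zero_iff, Real.norm_eq_abs]
          exact hU x hx
      exact analyticAt_id.div ((analyticAt_const.add analyticAt_id).pow 2)
        (pow_ne_zero 2 (hd x hx).ne')
  have hg : AnalyticOnNhd ℝ (gaussHypergeometric A (A + 1 - C) C) (Set.Ioo (-1 / 10) 1) :=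
    (analyticOnNhd_tsum_mul_pow fun x hx =>
      summable_abs_gaussHypergeometric A (A + 1 - C) hC hx).mono fun x hx => by
        rw [mem_ball_zero_iff, Real.norm_eq_abs, abs_lt]
        exact ⟨by linarith [hx.1], hx.2⟩
  refine hf.eqOn_of_preconnected_of_eventuallyEq hg isPreconnected_Ioo (z₀ := 0) (by norm_num) ?_
    ⟨by linarith, hz1⟩
  filter_upwards [Metric.ball_mem_nhds (0 : ℝ) (ε := 1 / 10) (by norm_num)] with x hx
  exact quadratic_transformation_of_abs_lt hA hC (by simpa using hx)

theorem Real.Gamma_add_natCast_eq_ascPochhammer {s : ℝ} (hs : 0 < s) (k : ℕ) :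
    Real.Gamma (s + k) = (ascPochhammer ℝ k).eval s * Real.Gamma s := by
  induction k with
  | zero => simp
  | succ k ih =>
    rw [Nat.cast_succ, ← add_assoc, Real.Gamma_add_one (by positivity), ih,
      ascPochhammer_succ_eval]
    ring

theorem integral_Ioi_pow_mul_exp_neg_sq (k : ℕ) :
    ∫ x in Set.Ioi (0 : ℝ), x ^ k * exp (-x ^ 2) = 1 / 2 * Real.Gamma ((k + 1) / 2) := by
  rw [← integral_rpow_mul_exp_neg_rpow two_pos (by linarith [(k.cast_nonneg : (0 : ℝ) ≤ k)])]
  simp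

theorem integral_even_pow_mul_exp_neg_sq (j : ℕ) :
    ∫ x : ℝ, x ^ (2 * j) * exp (-x ^ 2) = (ascPochhammer ℝ j).eval (1 / 2) * √π := by
  have h := integral_comp_abs (f := fun x : ℝ => x ^ (2 * j) * exp (-x ^ 2))
  simp only [pow_mul, sq_abs] at h
  simp only [pow_mul, h]
  simp only [← pow_mul]
  rw [integral_Ioi_pow_mul_exp_neg_sq, ← Real.Gamma_one_half_eq,
    ← Real.Gamma_add_natCast_eq_ascPochhammer (by norm_num)]
  push_cast
  ring_nf

theorem integral_odd_pow_mul_exp_neg_sq (j : ℕ) :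
    ∫ x : ℝ, x ^ (2 * j + 1) * exp (-x ^ 2) = 0 := by
  have h := integral_neg_eq_self (fun x : ℝ => x ^ (2 * j + 1) * exp (-x ^ 2)) volume
  simp only [Odd.neg_pow ⟨j, rfl⟩, neg_sq, neg_mul, integral_neg] at h
  linarith

theorem integral_pow_coord_mul_exp_neg_norm_sq {n : ℕ} (i : Fin n) (k : ℕ) :
    ∫ y : EuclideanSpace ℝ (Fin n), y i ^ k * exp (-‖y‖ ^ 2) =
      (∫ x : ℝ, x ^ k * exp (-x ^ 2)) * √π ^ (n - 1) := by
  have h0 : ∫ x : ℝ, x ^ 0 * exp (-x ^ 2) = √π := by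
    simpa using integral_gaussian 1
  calc _ = ∫ y : EuclideanSpace ℝ (Fin n),
        ∏ l, y l ^ (if l = i then k else 0) * exp (-y l ^ 2) := by
        congr with y
        rw [Finset.prod_mul_distrib, ← Real.exp_sum, EuclideanSpace.norm_sq_eq]
        simp [pow_ite]
    _ = ∫ y : Fin n → ℝ, ∏ l, y l ^ (if l = i then k else 0) * exp (-y l ^ 2) :=
        (EuclideanSpace.volume_preserving_symm_measurableEquiv_toLp (Fin n)).integral_comp'
          (fun y : Fin n → ℝ => ∏ l, y l ^ (if l = i then k else 0) * exp (-y l ^ 2))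
    _ = ∏ l, ∫ x : ℝ, x ^ (if l = i then k else 0) * exp (-x ^ 2) :=
        integral_fintype_prod_volume_eq_prod
          (fun l (x : ℝ) => x ^ (if l = i then k else 0) * exp (-x ^ 2))
    _ = _ := by
        rw [← Finset.mul_prod_erase _ _ (Finset.mem_univ i), if_pos rfl,
          Finset.prod_congr rfl fun l hl => by rw [if_neg (Finset.ne_of_mem_erase hl), h0]]
        simp

theorem EuclideanSpace.exists_orthonormalBasis_smul_eq {n : ℕ} (i : Fin n)
    (w : EuclideanSpace ℝ (Fin n)) :
    ∃ b : OrthonormalBasis (Fin n) ℝ (EuclideanSpace ℝ (Fin n)), w = ‖w‖ • b i := by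
  rcases eq_or_ne w 0 with rfl | hw
  · exact ⟨EuclideanSpace.basisFun _ ℝ, by simp⟩
  · obtain ⟨b, hb⟩ := Orthonormal.exists_orthonormalBasis_extension_of_card_eq (𝕜 := ℝ)
      (by simp) (v := fun _ : Fin n => ‖w‖⁻¹ • w) (s := {i}) (by
        rw [orthonormal_iff_ite]
        rintro ⟨x, rfl⟩ ⟨y, rfl⟩
        simp [norm_smul, hw])
    exact ⟨b, by rw [hb i rfl, smul_inv_smul₀ (norm_ne_zero_iff.mpr hw)]⟩

theorem integral_inner_pow_mul_exp_neg_norm_sq {n : ℕ} (hn : 0 < n)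
    (w : EuclideanSpace ℝ (Fin n)) (k : ℕ) :
    ∫ x : EuclideanSpace ℝ (Fin n), inner ℝ w x ^ k * exp (-‖x‖ ^ 2) =
      ‖w‖ ^ k * ((∫ x : ℝ, x ^ k * exp (-x ^ 2)) * √π ^ (n - 1)) := by
  obtain ⟨b, hb⟩ := EuclideanSpace.exists_orthonormalBasis_smul_eq ⟨0, hn⟩ w
  rw [← integral_pow_coord_mul_exp_neg_norm_sq ⟨0, hn⟩, ← integral_const_mul,
    ← b.measurePreserving_measurableEquiv.integral_comp'
      (fun y => ‖w‖ ^ k * (y ⟨0, hn⟩ ^ k * exp (-‖y‖ ^ 2)))]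
  congr with x
  change _ = ‖w‖ ^ k * ((b.repr x) ⟨0, hn⟩ ^ k * exp (-‖b.repr x‖ ^ 2))
  rw [b.repr.norm_map, b.repr_apply_apply, ← mul_assoc, ← mul_pow, ← real_inner_smul_left, ← hb]

/-- Integration in polar coordinates. -/
theorem integral_eq_integral_toSphere_prod_volumeIoiPow {E : Type*} [NormedAddCommGroup E]
    [NormedSpace ℝ E] [FiniteDimensional ℝ E] [Nontrivial E] [MeasurableSpace E] [BorelSpace E]
    (μ : Measure E) [μ.IsAddHaarMeasure] (f : E → ℝ) :
    ∫ x, f x ∂μ = ∫ p : Metric.sphere (0 : E) 1 × Set.Ioi (0 : ℝ), f ((p.2 : ℝ) • (p.1 : E))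
      ∂(μ.toSphere.prod (.volumeIoiPow (Module.finrank ℝ E - 1))) := by
  rw [← μ.measurePreserving_homeomorphUnitSphereProd.integral_comp
    (Homeomorph.measurableEmbedding _)]
  conv_lhs => rw [← restrict_compl_singleton (μ := μ) 0,
    ← integral_subtype_comap (measurableSet_singleton _).compl]
  congr with x
  have : ‖(x : E)‖ ≠ 0 := norm_ne_zero_iff.mpr x.2
  simp [smul_smul, this]

theorem integral_volumeIoiPow (n : ℕ) (f : ℝ → ℝ) :
    ∫ r : Set.Ioi (0 : ℝ), f r ∂(Measure.volumeIoiPow n) =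
      ∫ r in Set.Ioi (0 : ℝ), r ^ n * f r := by
  simp only [Measure.volumeIoiPow, ENNReal.ofReal]
  rw [integral_withDensity_eq_integral_smul,
    integral_subtype_comap measurableSet_Ioi fun a ↦ Real.toNNReal (a ^ n) • f a,
    setIntegral_congr_fun measurableSet_Ioi fun x hx ↦ ?_]
  · rw [NNReal.smul_def, Real.coe_toNNReal _ (pow_nonneg hx.out.le _), smul_eq_mul]
  · exact (measurable_subtype_coe.pow_const _).real_toNNReal

theorem integral_sphere_inner_pow_mul_Gamma {n : ℕ} (hn : 0 < n)
    (w : EuclideanSpace ℝ (Fin n)) (k : ℕ) :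
    (∫ ξ : Metric.sphere (0 : EuclideanSpace ℝ (Fin n)) 1,
      inner ℝ w (ξ : EuclideanSpace ℝ (Fin n)) ^ k ∂((volume).toSphere)) *
        (1 / 2 * Real.Gamma ((k + n) / 2)) =
      ‖w‖ ^ k * ((∫ x : ℝ, x ^ k * exp (-x ^ 2)) * √π ^ (n - 1)) := by
  have : Nontrivial (EuclideanSpace ℝ (Fin n)) :=
    Module.nontrivial_of_finrank_pos (R := ℝ) (by simpa using hn)
  rw [← integral_inner_pow_mul_exp_neg_norm_sq hn,
    integral_eq_integral_toSphere_prod_volumeIoiPow (E := EuclideanSpace ℝ (Fin n))]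
  have h : 1 / 2 * Real.Gamma ((k + n) / 2) =
      ∫ r : Set.Ioi (0 : ℝ), (r : ℝ) ^ k * exp (-(r : ℝ) ^ 2)
        ∂(Measure.volumeIoiPow (Module.finrank ℝ (EuclideanSpace ℝ (Fin n)) - 1)) := by
    rw [integral_volumeIoiPow _ fun r => r ^ k * exp (-r ^ 2)]
    simp only [← mul_assoc, ← pow_add]
    rw [integral_Ioi_pow_mul_exp_neg_sq, finrank_euclideanSpace_fin]
    push_cast [Nat.cast_sub hn]
    ring_nf
  rw [h, ← integral_prod_mul]
  congr with p
  have hp : 0 < (p.2 : ℝ) := p.2.2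
  rw [real_inner_smul_right, norm_smul, Real.norm_eq_abs, abs_of_pos hp, norm_eq_of_mem_sphere]
  ring_nf

theorem integral_sphere_inner_odd_pow {n : ℕ} (hn : 0 < n)
    (w : EuclideanSpace ℝ (Fin n)) (j : ℕ) :
    ∫ ξ : Metric.sphere (0 : EuclideanSpace ℝ (Fin n)) 1,
      inner ℝ w (ξ : EuclideanSpace ℝ (Fin n)) ^ (2 * j + 1) ∂((volume).toSphere) = 0 := by
  have h := integral_sphere_inner_pow_mul_Gamma hn w (2 * j + 1)
  rw [integral_odd_pow_mul_exp_neg_sq, zero_mul, mul_zero] at h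
  have hn' : (0 : ℝ) < n := by exact_mod_cast hn
  exact (mul_eq_zero.mp h).resolve_right
    (mul_ne_zero (by norm_num) (Real.Gamma_pos_of_pos (by positivity)).ne')

theorem integral_sphere_inner_even_pow {n : ℕ} (hn : 0 < n)
    (w : EuclideanSpace ℝ (Fin n)) (j : ℕ) :
    ∫ ξ : Metric.sphere (0 : EuclideanSpace ℝ (Fin n)) 1,
      inner ℝ w (ξ : EuclideanSpace ℝ (Fin n)) ^ (2 * j) ∂((volume).toSphere) =
    (2 * π ^ ((n : ℝ) / 2) / Real.Gamma (n / 2)) *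
      ((ascPochhammer ℝ j).eval (1 / 2) / (ascPochhammer ℝ j).eval ((n : ℝ) / 2)) *
        (‖w‖ ^ 2) ^ j := by
  have h := integral_sphere_inner_pow_mul_Gamma hn w (2 * j)
  have hn' : (0 : ℝ) < n / 2 := by
    have : (0 : ℝ) < n := by exact_mod_cast hn
    positivity
  have hG := (Real.Gamma_pos_of_pos hn').ne'
  have hP := (ascPochhammer_pos j _ hn').ne'
  rw [integral_even_pow_mul_exp_neg_sq,
    show (((2 * j : ℕ) : ℝ) + n) / 2 = n / 2 + j by push_cast; ring,
    Real.Gamma_add_natCast_eq_ascPochhammer hn', mul_assoc _ √π, ← pow_succ',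
    Nat.sub_add_cancel hn, pow_mul] at h
  have hpi : √π ^ n = π ^ ((n : ℝ) / 2) := by
    rw [Real.sqrt_eq_rpow, ← Real.rpow_natCast, ← Real.rpow_mul Real.pi_nonneg]
    ring_nf
  rw [hpi] at h
  field_simp
  linear_combination 2 * h

theorem ascPochhammer_eval_half_mul (j : ℕ) :
    (ascPochhammer ℝ j).eval (1 / 2) * (4 ^ j * j.factorial) = (2 * j).factorial := by
  induction j with
  | zero => simp
  | succ j ih =>
    rw [show 2 * (j + 1) = 2 * j + 1 + 1 by ring, Nat.factorial_succ, Nat.factorial_succ,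
      Nat.factorial_succ, ascPochhammer_succ_eval]
    push_cast
    rw [← ih]
    ring

theorem hasSum_integral_sphere_one_sub_inner_rpow_neg {n : ℕ} (A : ℝ) {c : ℝ}
    (w : EuclideanSpace ℝ (Fin n)) (hc : |c| * ‖w‖ < 1) :
    HasSum (fun k : ℕ => (ascPochhammer ℝ k).eval A / k.factorial * c ^ k *
      ∫ ξ : Metric.sphere (0 : EuclideanSpace ℝ (Fin n)) 1,
        inner ℝ w (ξ : EuclideanSpace ℝ (Fin n)) ^ k ∂((volume).toSphere))
      (∫ ξ : Metric.sphere (0 : EuclideanSpace ℝ (Fin n)) 1,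
        (1 - c * inner ℝ w (ξ : EuclideanSpace ℝ (Fin n))) ^ (-A) ∂((volume).toSphere)) := by
  have hle (ξ : Metric.sphere (0 : EuclideanSpace ℝ (Fin n)) 1) :
      |c * inner ℝ w (ξ : EuclideanSpace ℝ (Fin n))| ≤ |c| * ‖w‖ := by
    rw [abs_mul]
    gcongr
    simpa using abs_real_inner_le_norm w ξ
  have hb : |(|c| * ‖w‖)| < 1 := by rwa [abs_of_nonneg (by positivity)]
  have h := hasSum_integral_of_dominated_convergence
    (μ := (volume : Measure (EuclideanSpace ℝ (Fin n))).toSphere)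
    (F := fun (k : ℕ) ξ => (ascPochhammer ℝ k).eval A / k.factorial *
      (c * inner ℝ w (ξ : EuclideanSpace ℝ (Fin n))) ^ k)
    (f := fun ξ => (1 - c * inner ℝ w (ξ : EuclideanSpace ℝ (Fin n))) ^ (-A))
    (fun k _ => |(ascPochhammer ℝ k).eval A / k.factorial * (|c| * ‖w‖) ^ k|)
    (fun k => Continuous.aestronglyMeasurable (by fun_prop))
    (fun k => .of_forall fun ξ => by
      rw [Real.norm_eq_abs, abs_mul, abs_mul, abs_pow, abs_pow, abs_of_nonneg (a := |c| * ‖w‖)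
        (by positivity)]
      gcongr
      exact hle ξ)
    (.of_forall fun ξ => (hasSum_one_sub_rpow_neg A hb).summable.abs)
    (integrable_const _)
    (.of_forall fun ξ => hasSum_one_sub_rpow_neg A ((hle ξ).trans_lt hc))
  convert! h using 2 with k
  rw [integral_const_mul]
  simp only [mul_pow]
  rw [integral_const_mul, mul_assoc]

/-- For `a > 0` and `|w| < 1`,
`∫_{S^{n−1}} |w+ξ|^{−a} dσ(ξ) = (2π^{n/2}/Γ(n/2)) F(a/2, a/2+1−n/2; n/2; |w|²)`,
where `σ` is the surface measure on the unit sphere. -/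
theorem sphere_integral_eq_hypergeometric (n : ℕ) (hn : 2 ≤ n) (a : ℝ) (ha : 0 < a)
    (w : EuclideanSpace ℝ (Fin n)) (hw : ‖w‖ < 1) :
    (∫ ξ : Metric.sphere (0 : EuclideanSpace ℝ (Fin n)) 1,
        ‖w + (ξ : EuclideanSpace ℝ (Fin n))‖ ^ (-a) ∂((volume).toSphere)) =
      (2 * π ^ ((n : ℝ) / 2) / Real.Gamma (n / 2)) *
        gaussHypergeometric (a / 2) (a / 2 + 1 - n / 2) (n / 2) (‖w‖ ^ 2) := by
  have hn0 : 0 < n := by omega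
  have hC : (0 : ℝ) < n / 2 := by
    have : (0 : ℝ) < n := by exact_mod_cast hn0
    positivity
  have hw0 := norm_nonneg w
  set z := ‖w‖ ^ 2 with hz
  have hz0 : 0 < 1 + z := by positivity
  have hz1 : z < 1 := by rw [hz]; nlinarith
  set c : ℝ := -(2 / (1 + z)) with hc
  have hcw : |c| * ‖w‖ < 1 := by
    rw [hc, abs_neg, abs_of_pos (by positivity), div_mul_eq_mul_div, div_lt_one hz0, hz]
    nlinarith [sq_pos_of_pos (sub_pos.2 hw)]
  have hnorm (ξ : Metric.sphere (0 : EuclideanSpace ℝ (Fin n)) 1) :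
      ‖w + (ξ : EuclideanSpace ℝ (Fin n))‖ ^ (-a) = (1 + z) ^ (-(a / 2)) *
        (1 - c * inner ℝ w (ξ : EuclideanSpace ℝ (Fin n))) ^ (-(a / 2)) := by
    have hsq : ‖w + (ξ : EuclideanSpace ℝ (Fin n))‖ ^ 2 =
        (1 + z) * (1 - c * inner ℝ w (ξ : EuclideanSpace ℝ (Fin n))) := by
      rw [norm_add_sq_real, norm_eq_of_mem_sphere, hc]
      field_simp
      ring
    have hnn : 0 ≤ 1 - c * inner ℝ w (ξ : EuclideanSpace ℝ (Fin n)) :=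
      nonneg_of_mul_nonneg_right (hsq ▸ sq_nonneg _) hz0
    rw [← Real.mul_rpow hz0.le hnn, ← hsq, ← Real.rpow_natCast, ← Real.rpow_mul (norm_nonneg _)]
    congr 1
    push_cast
    ring
  simp only [hnorm]
  rw [integral_const_mul, ← (hasSum_integral_sphere_one_sub_inner_rpow_neg _ w hcw).tsum_eq,
    ← (mul_right_injective₀ (two_ne_zero (α := ℕ))).tsum_eq,
    mul_comm _ (gaussHypergeometric _ _ _ _),
    ← quadratic_transformation (half_pos ha) hC (by positivity) hz1, mul_assoc, ← tsum_mul_right]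
  · congr 1
    refine tsum_congr fun j => ?_
    rw [integral_sphere_inner_even_pow hn0, ← ascPochhammer_eval_half_mul, pow_mul c, hc, neg_sq,
      div_pow, div_pow, div_pow]
    have h1 := (ascPochhammer_pos j _ hC).ne'
    have h2 := (ascPochhammer_pos j (1 / 2 : ℝ) (by norm_num)).ne'
    have h3 := (Real.Gamma_pos_of_pos hC).ne'
    rw [show (2 : ℝ) ^ 2 = 4 by norm_num]
    field_simp
    rw [hz]
  · intro k hk
    rcases k.even_or_odd' with ⟨j, rfl | rfl⟩
    · exact ⟨j, rfl⟩
    · exact absurd (by simp only [integral_sphere_inner_odd_pow hn0, mul_zero]) hk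
end

section
/- Let n > 2 be an integer. For every x in the open unit ball B^n, ∫_{B^n} |y| (1−|x|²) / [x,y]^n dy = (ω_{n−1}/(n+1)) (1−|x|²) F(1, (n+1)/2; (n+3)/2; |x|²), and this quantity is at most ω_{n−1}/(n+1) = ∫_{B^n} |y| dy, with equality when x = 0. -/
open Real MeasureTheory
open scoped RealInnerProductSpace

/-- The square of `[t x, y]`. -/
noncomputable def bracketSq {n : ℕ} (t : ℝ) (x y : EuclideanSpace ℝ (Fin n)) : ℝ :=
  t ^ 2 * (‖x‖ ^ 2 * ‖y‖ ^ 2) - 2 * t * ⟪x, y⟫ + 1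

/-- `⟨V_t(y), y⟩` for the divergence-free field `V_t(y) = (t|x|²y − x) / [tx,y]^n`. -/
noncomputable def radialFlux {n : ℕ} (t : ℝ) (x y : EuclideanSpace ℝ (Fin n)) : ℝ :=
  (t * ‖x‖ ^ 2 * ‖y‖ ^ 2 - ⟪x, y⟫) * bracketSq t x y ^ (-((n : ℝ) / 2))

theorem sq_le_bracketSq {n : ℕ} {t T : ℝ} {x y : EuclideanSpace ℝ (Fin n)}
    (ht : |t| ≤ T) (hT : T * ‖x‖ ≤ 1) (hy : ‖y‖ ≤ 1) :
    (1 - T * ‖x‖) ^ 2 ≤ bracketSq t x y := by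
  have h1 : t * ⟪x, y⟫ ≤ |t| * (‖x‖ * ‖y‖) := by
    calc t * ⟪x, y⟫ ≤ |t * ⟪x, y⟫| := le_abs_self _
      _ = |t| * |⟪x, y⟫| := abs_mul _ _
      _ ≤ _ := by gcongr; exact abs_real_inner_le_norm x y
  have h2 : |t| * (‖x‖ * ‖y‖) ≤ T * ‖x‖ := by
    calc |t| * (‖x‖ * ‖y‖) ≤ T * (‖x‖ * 1) := by
          have : 0 ≤ T := (abs_nonneg t).trans ht
          gcongr
      _ = _ := by ring
  have h3 : (1 - T * ‖x‖) ^ 2 ≤ (1 - |t| * (‖x‖ * ‖y‖)) ^ 2 :=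
    pow_le_pow_left₀ (by linarith) (by linarith) 2
  have h4 : t ^ 2 = |t| ^ 2 := (sq_abs t).symm
  unfold bracketSq
  rw [h4]
  nlinarith

theorem bracketSq_pos {n : ℕ} {t : ℝ} {x y : EuclideanSpace ℝ (Fin n)}
    (ht : |t| * ‖x‖ < 1) (hy : ‖y‖ ≤ 1) : 0 < bracketSq t x y :=
  lt_of_lt_of_le (by have : 0 < 1 - |t| * ‖x‖ := by linarith
                     positivity) (sq_le_bracketSq le_rfl ht.le hy)

theorem continuous_bracketSq {n : ℕ} (t : ℝ) (x : EuclideanSpace ℝ (Fin n)) :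
    Continuous (bracketSq t x) := by
  unfold bracketSq
  fun_prop

theorem continuousOn_bracketSq_rpow {n : ℕ} {t : ℝ} {x : EuclideanSpace ℝ (Fin n)}
    (ht : |t| * ‖x‖ < 1) (p : ℝ) :
    ContinuousOn (fun y => bracketSq t x y ^ p) (Metric.closedBall 0 1) :=
  (continuous_bracketSq t x).continuousOn.rpow_const fun _ hy =>
    Or.inl (bracketSq_pos ht (mem_closedBall_zero_iff.1 hy)).ne'

theorem continuousOn_radialFlux {n : ℕ} {t : ℝ} {x : EuclideanSpace ℝ (Fin n)}
    (ht : |t| * ‖x‖ < 1) : ContinuousOn (radialFlux t x) (Metric.closedBall 0 1) :=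
  ContinuousOn.mul (by fun_prop) (continuousOn_bracketSq_rpow ht _)

theorem hasDerivAt_bracketSq_line {n : ℕ} (t : ℝ) (x y v : EuclideanSpace ℝ (Fin n)) :
    HasDerivAt (fun s : ℝ => bracketSq t x (y + s • v))
      (2 * t * (t * ‖x‖ ^ 2 * ⟪y, v⟫ - ⟪x, v⟫)) 0 := by
  have hl : HasDerivAt (fun s : ℝ => y + s • v) v 0 := by
    simpa using ((hasDerivAt_id (0 : ℝ)).smul_const v).const_add y
  have hN := hl.norm_sq
  have hI := (hasDerivAt_const (0 : ℝ) x).inner ℝ hl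
  have := (((hN.const_mul (‖x‖ ^ 2)).const_mul (t ^ 2)).sub (hI.const_mul (2 * t))).add_const 1
  simp only [zero_smul, add_zero, inner_zero_left] at this
  refine this.congr_deriv ?_
  ring

theorem integrable_of_continuousOn_closedBall {n : ℕ} {f : EuclideanSpace ℝ (Fin n) → ℝ}
    (hf : ContinuousOn f (Metric.closedBall 0 1)) (h0 : ∀ y, 1 < ‖y‖ → f y = 0) :
    Integrable f := by
  refine (integrableOn_iff_integrable_of_support_subset ?_).1
    (hf.integrableOn_compact (isCompact_closedBall _ _))
  intro y hy
  by_contra h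
  exact hy (h0 y (by simpa using h))

/-- The divergence theorem for `V_t`, tested against continuous radial weights. -/
theorem integral_mul_radialFlux_eq_zero_of_continuous {n : ℕ} {t : ℝ}
    {x : EuclideanSpace ℝ (Fin n)} (ht : |t| * ‖x‖ < 1) {χ : ℝ → ℝ} (hχ : Continuous χ)
    (hχ0 : ∀ s, 1 ≤ s → χ s = 0) :
    ∫ y : EuclideanSpace ℝ (Fin n), χ (‖y‖ ^ 2) * radialFlux t x y = 0 := by
  set ψ : ℝ → ℝ := fun s => ∫ u in (1 : ℝ)..s, χ u with hψ
  have hψd (s : ℝ) : HasDerivAt ψ (χ s) s :=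
    intervalIntegral.integral_hasDerivAt_right (hχ.intervalIntegrable _ _)
      hχ.aestronglyMeasurable.stronglyMeasurableAtFilter hχ.continuousAt
  have hψc : Continuous ψ := continuous_iff_continuousAt.2 fun s => (hψd s).continuousAt
  have hψ0 (s : ℝ) (hs : 1 ≤ s) : ψ s = 0 := by
    refine (intervalIntegral.integral_congr (g := fun _ => (0 : ℝ)) fun u hu => ?_).trans
      (by simp)
    rw [Set.uIcc_of_le hs] at hu
    exact hχ0 u hu.1
  set p : ℝ := (n : ℝ) / 2 with hp
  let e (i : Fin n) : EuclideanSpace ℝ (Fin n) := EuclideanSpace.single i 1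
  let V (i : Fin n) (y : EuclideanSpace ℝ (Fin n)) : ℝ :=
    (t * ‖x‖ ^ 2 * y i - x i) * bracketSq t x y ^ (-p)
  let V' (i : Fin n) (y : EuclideanSpace ℝ (Fin n)) : ℝ :=
    t * ‖x‖ ^ 2 * bracketSq t x y ^ (-p) + (t * ‖x‖ ^ 2 * y i - x i) *
      (2 * t * (t * ‖x‖ ^ 2 * y i - x i) * -p * bracketSq t x y ^ (-p - 1))
  have hV (i : Fin n) : ContinuousOn (V i) (Metric.closedBall 0 1) :=
    ContinuousOn.mul (by fun_prop) (continuousOn_bracketSq_rpow ht _)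
  have hV' (i : Fin n) : ContinuousOn (V' i) (Metric.closedBall 0 1) :=
    (ContinuousOn.mul (by fun_prop) (continuousOn_bracketSq_rpow ht _)).add
      (ContinuousOn.mul (by fun_prop) (ContinuousOn.mul (by fun_prop)
        (continuousOn_bracketSq_rpow ht _)))
  have hone {y : EuclideanSpace ℝ (Fin n)} (hy : 1 < ‖y‖) : 1 ≤ ‖y‖ ^ 2 :=
    one_le_pow₀ hy.le
  have hint1 (i : Fin n) : Integrable fun y : EuclideanSpace ℝ (Fin n) =>
      2 * y i * χ (‖y‖ ^ 2) * V i y :=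
    integrable_of_continuousOn_closedBall (ContinuousOn.mul (by fun_prop) (hV i))
      fun y hy => by simp [hχ0 _ (hone hy)]
  have hint2 (i : Fin n) : Integrable fun y : EuclideanSpace ℝ (Fin n) =>
      ψ (‖y‖ ^ 2) * V' i y :=
    integrable_of_continuousOn_closedBall (ContinuousOn.mul (by fun_prop) (hV' i))
      fun y hy => by simp [hψ0 _ (hone hy)]
  have hint3 (i : Fin n) : Integrable fun y : EuclideanSpace ℝ (Fin n) =>
      ψ (‖y‖ ^ 2) * V i y :=
    integrable_of_continuousOn_closedBall (ContinuousOn.mul (by fun_prop) (hV i))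
      fun y hy => by simp [hψ0 _ (hone hy)]
  have hin (y : EuclideanSpace ℝ (Fin n)) (i : Fin n) : ⟪y, e i⟫ = y i := by
    simp [e, EuclideanSpace.inner_single_right]
  have hparts (i : Fin n) :
      ∫ y : EuclideanSpace ℝ (Fin n), ψ (‖y‖ ^ 2) * V' i y =
        -∫ y : EuclideanSpace ℝ (Fin n), 2 * y i * χ (‖y‖ ^ 2) * V i y := by
    refine integral_bilinear_hasLineDerivAt_right_eq_neg_left_of_integrable
      (B := ContinuousLinearMap.mul ℝ ℝ) (f := fun y => ψ (‖y‖ ^ 2))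
      (f' := fun y => 2 * y i * χ (‖y‖ ^ 2)) (g := V i) (g' := V' i) (v := e i)
      (hint1 i) (hint2 i) (hint3 i) ?_ ?_
    · intro y _
      have hl : HasDerivAt (fun s : ℝ => y + s • e i) (e i) 0 := by
        simpa using ((hasDerivAt_id (0 : ℝ)).smul_const (e i)).const_add y
      have := HasDerivAt.comp (0 : ℝ) (hψd _) hl.norm_sq
      simp only [zero_smul, add_zero, hin] at this
      exact this.congr_deriv (by ring)
    · intro y hy
      have hy1 : ‖y‖ ≤ 1 := by
        have : tsupport (fun y : EuclideanSpace ℝ (Fin n) => ψ (‖y‖ ^ 2)) ⊆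
            Metric.closedBall 0 1 := by
          refine closure_minimal (fun z hz => ?_) Metric.isClosed_closedBall
          by_contra h
          exact hz (hψ0 _ (hone (by simpa using h)))
        simpa using this hy
      have hc : HasDerivAt (fun s : ℝ => t * ‖x‖ ^ 2 * (y + s • e i) i - x i)
          (t * ‖x‖ ^ 2) 0 := by
        have : HasDerivAt (fun s : ℝ => t * ‖x‖ ^ 2 * (y i + s) - x i) (t * ‖x‖ ^ 2 * 1) 0 :=
          (((hasDerivAt_id (0 : ℝ)).const_add (y i)).const_mul _).sub_const _
        simpa [e] using this
      have hb := hasDerivAt_bracketSq_line t x y (e i)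
      have hpos := bracketSq_pos ht hy1
      have := hc.mul (hb.rpow_const (p := -p) (Or.inl (by simpa using hpos.ne')))
      simp only [zero_smul, add_zero, hin] at this
      exact this
  have hdiv (y : EuclideanSpace ℝ (Fin n)) : ∑ i, ψ (‖y‖ ^ 2) * V' i y = 0 := by
    rw [← Finset.mul_sum]
    rcases le_or_gt ‖y‖ 1 with hy | hy
    · have hpos := bracketSq_pos ht hy
      have hsq : ∑ i, (t * ‖x‖ ^ 2 * y i - x i) ^ 2 = ‖x‖ ^ 2 * bracketSq t x y := by
        have h1 : ∑ i, (t * ‖x‖ ^ 2 * y i - x i) ^ 2 = ‖(t * ‖x‖ ^ 2) • y - x‖ ^ 2 := by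
          rw [EuclideanSpace.norm_sq_eq ((t * ‖x‖ ^ 2) • y - x)]; simp
        rw [h1, norm_sub_sq_real, norm_smul, inner_smul_left, real_inner_comm, mul_pow,
          Real.norm_eq_abs, sq_abs]
        simp only [bracketSq, conj_trivial]
        ring
      have hrp : bracketSq t x y ^ (-p) = bracketSq t x y * bracketSq t x y ^ (-p - 1) := by
        rw [Real.rpow_sub_one hpos.ne', mul_div_cancel₀ _ hpos.ne']
      have : ∑ i, V' i y = 0 := by
        calc ∑ i, V' i y = ∑ i, (t * ‖x‖ ^ 2 * bracketSq t x y ^ (-p) +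
              (t * ‖x‖ ^ 2 * y i - x i) ^ 2 * (2 * t * -p * bracketSq t x y ^ (-p - 1))) :=
              Finset.sum_congr rfl fun i _ => by simp only [V']; ring
          _ = 0 := by
              rw [Finset.sum_add_distrib, ← Finset.sum_mul _ (fun i => (t * ‖x‖ ^ 2 * y i - x i) ^ 2), hsq,
                hrp]
              simp [hp]
              ring
      rw [this, mul_zero]
    · rw [hψ0 _ (hone hy), zero_mul]
  have hsum : ∑ i, ∫ y : EuclideanSpace ℝ (Fin n), 2 * y i * χ (‖y‖ ^ 2) * V i y = 0 := by
    rw [← neg_eq_zero, ← Finset.sum_neg_distrib, ← Finset.sum_congr rfl fun i _ => hparts i,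
      ← integral_finsetSum _ fun i _ => hint2 i]
    simp [hdiv]
  rw [← integral_finsetSum _ fun i _ => hint1 i] at hsum
  have : ∀ y : EuclideanSpace ℝ (Fin n), ∑ i, 2 * y i * χ (‖y‖ ^ 2) * V i y =
      2 * (χ (‖y‖ ^ 2) * radialFlux t x y) := by
    intro y
    have h1 : ‖y‖ ^ 2 = ∑ i, y i * y i := by
      rw [EuclideanSpace.norm_sq_eq]; simp [sq]
    have h2 : ⟪x, y⟫ = ∑ i, x i * y i := by
      simp [PiLp.inner_apply, mul_comm]
    calc ∑ i, 2 * y i * χ (‖y‖ ^ 2) * V i y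
        = ∑ i, (2 * χ (‖y‖ ^ 2) * bracketSq t x y ^ (-p)) *
            (t * ‖x‖ ^ 2 * (y i * y i) - x i * y i) :=
          Finset.sum_congr rfl fun i _ => by simp only [V]; ring
      _ = _ := by
          rw [← Finset.mul_sum, Finset.sum_sub_distrib, ← Finset.mul_sum, ← h1, ← h2, radialFlux]
          ring
  simp_rw [this, integral_const_mul] at hsum
  linarith

theorem integrable_mul_of_continuousOn_closedBall {n : ℕ} {f : EuclideanSpace ℝ (Fin n) → ℝ}
    (hf : ContinuousOn f (Metric.closedBall 0 1)) {χ : ℝ → ℝ} (hχ : Continuous χ) :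
    IntegrableOn (fun y => χ (‖y‖ ^ 2) * f y) (Metric.ball 0 1) :=
  ((ContinuousOn.mul (by fun_prop) hf).integrableOn_compact
    (isCompact_closedBall _ _)).mono_set Metric.ball_subset_closedBall

theorem setIntegral_ball_mul_radialFlux_eq_zero {n : ℕ} {t : ℝ}
    {x : EuclideanSpace ℝ (Fin n)} (ht : |t| * ‖x‖ < 1) {χ : ℝ → ℝ} (hχ : Continuous χ) :
    ∫ y in Metric.ball (0 : EuclideanSpace ℝ (Fin n)) 1,
      χ (‖y‖ ^ 2) * radialFlux t x y = 0 := by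
  let c (k : ℕ) (s : ℝ) : ℝ := min 1 (k * max 0 (1 - s))
  have hc0 (k : ℕ) (s : ℝ) : 0 ≤ c k s := le_min zero_le_one (by positivity)
  have hc1 (k : ℕ) (s : ℝ) : c k s ≤ 1 := min_le_left _ _
  have hcs (k : ℕ) (s : ℝ) (hs : 1 ≤ s) : c k s = 0 := by
    simp [c, max_eq_left (sub_nonpos.2 hs)]
  have hzero (k : ℕ) : ∫ y in Metric.ball (0 : EuclideanSpace ℝ (Fin n)) 1,
      c k (‖y‖ ^ 2) * (χ (‖y‖ ^ 2) * radialFlux t x y) = 0 := by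
    rw [setIntegral_eq_integral_of_forall_compl_eq_zero]
    · simp_rw [← mul_assoc]
      exact integral_mul_radialFlux_eq_zero_of_continuous ht
        (χ := fun s => c k s * χ s) (by fun_prop) fun s hs => by simp [hcs k s hs]
    · intro y hy
      rw [hcs, zero_mul]
      exact one_le_pow₀ (by simpa using hy)
  have hint := integrable_mul_of_continuousOn_closedBall (continuousOn_radialFlux ht) hχ
  have hlim : Filter.Tendsto (fun k : ℕ => ∫ y in Metric.ball (0 : EuclideanSpace ℝ (Fin n)) 1,
      c k (‖y‖ ^ 2) * (χ (‖y‖ ^ 2) * radialFlux t x y)) Filter.atTop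
      (nhds (∫ y in Metric.ball (0 : EuclideanSpace ℝ (Fin n)) 1,
        χ (‖y‖ ^ 2) * radialFlux t x y)) := by
    refine tendsto_integral_of_dominated_convergence
      (fun y => ‖χ (‖y‖ ^ 2) * radialFlux t x y‖) (fun k => ?_) hint.norm (fun k => ?_) ?_
    · exact (Continuous.aestronglyMeasurable (by fun_prop)).mul hint.aestronglyMeasurable
    · refine Filter.Eventually.of_forall fun y => ?_
      rw [norm_mul, Real.norm_of_nonneg (hc0 _ _)]
      exact mul_le_of_le_one_left (norm_nonneg _) (hc1 _ _)
    · refine (ae_restrict_iff' measurableSet_ball).2 (Filter.Eventually.of_forall fun y hy => ?_)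
      have hy' : ‖y‖ < 1 := by simpa using hy
      have hpos : 0 < 1 - ‖y‖ ^ 2 := by
        have := pow_lt_one₀ (norm_nonneg y) hy' two_ne_zero
        linarith
      refine tendsto_const_nhds.congr' ?_
      filter_upwards [Filter.eventually_ge_atTop ⌈(1 - ‖y‖ ^ 2)⁻¹⌉₊] with k hk
      have h1 : (1 - ‖y‖ ^ 2)⁻¹ ≤ (k : ℝ) := (Nat.le_ceil _).trans (by exact_mod_cast hk)
      have h2 : 1 ≤ (k : ℝ) * (1 - ‖y‖ ^ 2) := by
        rwa [inv_le_iff_one_le_mul₀ hpos] at h1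
      have : c k (‖y‖ ^ 2) = 1 := by
        simp only [c, max_eq_right hpos.le, min_eq_left h2]
      rw [this, one_mul]
  simp only [hzero] at hlim
  exact (tendsto_nhds_unique hlim tendsto_const_nhds)

theorem hasDerivAt_bracketSq_rpow {n : ℕ} {t : ℝ} {x y : EuclideanSpace ℝ (Fin n)}
    (h : bracketSq t x y ≠ 0) :
    HasDerivAt (fun s => bracketSq s x y ^ (1 - (n : ℝ) / 2)) ((2 - n) * radialFlux t x y) t := by
  have hb : HasDerivAt (fun s => bracketSq s x y)
      (2 * t * (‖x‖ ^ 2 * ‖y‖ ^ 2) - 2 * ⟪x, y⟫) t := by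
    have := ((((hasDerivAt_id t).pow 2).mul_const (‖x‖ ^ 2 * ‖y‖ ^ 2)).sub
      (((hasDerivAt_id t).const_mul 2).mul_const ⟪x, y⟫)).add_const 1
    exact this.congr_deriv (by simp)
  refine (hb.rpow_const (p := 1 - (n : ℝ) / 2) (Or.inl h)).congr_deriv ?_
  rw [radialFlux, show 1 - (n : ℝ) / 2 - 1 = -((n : ℝ) / 2) by ring]
  ring

theorem abs_radialFlux_le {n : ℕ} {t T : ℝ} {x y : EuclideanSpace ℝ (Fin n)}
    (ht : |t| ≤ T) (hT : T * ‖x‖ < 1) (hx : ‖x‖ ≤ 1) (hy : ‖y‖ ≤ 1) :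
    |radialFlux t x y| ≤ (T + 1) * ((1 - T * ‖x‖) ^ 2) ^ (-((n : ℝ) / 2)) := by
  have hT0 : 0 ≤ T := (abs_nonneg t).trans ht
  have hpos : 0 < (1 - T * ‖x‖) ^ 2 := pow_pos (by linarith) 2
  have hle := sq_le_bracketSq ht hT.le hy
  rw [radialFlux, abs_mul, abs_of_nonneg (Real.rpow_nonneg (hpos.le.trans hle) _)]
  refine mul_le_mul ?_ (Real.rpow_le_rpow_of_nonpos hpos hle (by simp; positivity))
    (Real.rpow_nonneg (hpos.le.trans hle) _) (by positivity)
  refine (abs_sub _ _).trans (add_le_add ?_ ?_)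
  · rw [abs_mul, abs_mul, abs_of_nonneg (sq_nonneg ‖x‖), abs_of_nonneg (sq_nonneg ‖y‖)]
    calc |t| * ‖x‖ ^ 2 * ‖y‖ ^ 2 ≤ T * 1 ^ 2 * 1 ^ 2 := by gcongr
      _ = T := by ring
  · calc |⟪x, y⟫| ≤ ‖x‖ * ‖y‖ := abs_real_inner_le_norm x y
      _ ≤ 1 * 1 := by gcongr
      _ = 1 := by ring

/-- Mean value property of `[x,y]^{2-n}` against radial weights. -/
theorem setIntegral_ball_mul_bracketSq_rpow {n : ℕ} {x : EuclideanSpace ℝ (Fin n)}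
    (hx : ‖x‖ < 1) {χ : ℝ → ℝ} (hχ : Continuous χ) :
    ∫ y in Metric.ball (0 : EuclideanSpace ℝ (Fin n)) 1,
      χ (‖y‖ ^ 2) * bracketSq 1 x y ^ (1 - (n : ℝ) / 2) =
    ∫ y in Metric.ball (0 : EuclideanSpace ℝ (Fin n)) 1, χ (‖y‖ ^ 2) := by
  obtain ⟨T, hT1, hTx⟩ : ∃ T : ℝ, 1 < T ∧ T * ‖x‖ < 1 := by
    refine ⟨2 / (1 + ‖x‖), ?_, ?_⟩
    · rw [lt_div_iff₀ (by positivity)]; linarith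
    · rw [div_mul_eq_mul_div, div_lt_one (by positivity)]; linarith
  have hsmall {t : ℝ} (ht : |t| ≤ T) : |t| * ‖x‖ < 1 :=
    (mul_le_mul_of_nonneg_right ht (norm_nonneg x)).trans_lt hTx
  have hχint : IntegrableOn (fun y : EuclideanSpace ℝ (Fin n) => χ (‖y‖ ^ 2))
      (Metric.ball 0 1) := by
    simpa using integrable_mul_of_continuousOn_closedBall (n := n) (f := fun _ => 1)
      continuousOn_const hχ
  have hderiv (t : ℝ) (ht : t ∈ Set.Icc (0 : ℝ) 1) :
      HasDerivAt (fun t => ∫ y in Metric.ball (0 : EuclideanSpace ℝ (Fin n)) 1,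
        χ (‖y‖ ^ 2) * bracketSq t x y ^ (1 - (n : ℝ) / 2)) 0 t := by
    have htT : |t| < T := by rw [abs_of_nonneg ht.1]; linarith [ht.2]
    have hs : {s : ℝ | |s| < T} ∈ nhds t :=
      (isOpen_lt continuous_abs continuous_const).mem_nhds htT
    have hmem {s : ℝ} (hs : |s| < T) := integrable_mul_of_continuousOn_closedBall
      (continuousOn_bracketSq_rpow (hsmall hs.le) (1 - (n : ℝ) / 2)) hχ
    have hF := integrable_mul_of_continuousOn_closedBall
      (continuousOn_radialFlux (hsmall htT.le)) hχ
    have key := hasDerivAt_integral_of_dominated_loc_of_deriv_le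
      (μ := volume.restrict (Metric.ball (0 : EuclideanSpace ℝ (Fin n)) 1))
      (F := fun t y => χ (‖y‖ ^ 2) * bracketSq t x y ^ (1 - (n : ℝ) / 2))
      (F' := fun t y => (2 - n) * (χ (‖y‖ ^ 2) * radialFlux t x y))
      (bound := fun y => ‖χ (‖y‖ ^ 2)‖ *
        (|2 - (n : ℝ)| * ((T + 1) * ((1 - T * ‖x‖) ^ 2) ^ (-((n : ℝ) / 2)))))
      hs (Filter.mem_of_superset hs fun s hs => (hmem hs).aestronglyMeasurable)
      (hmem htT) (hF.aestronglyMeasurable.const_mul _) ?_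
      (hχint.norm.mul_const _) ?_
    · have := key.2
      rwa [integral_const_mul, setIntegral_ball_mul_radialFlux_eq_zero (hsmall htT.le) hχ,
        mul_zero] at this
    · refine (ae_restrict_iff' measurableSet_ball).2 (Filter.Eventually.of_forall
        fun y hy s hs => ?_)
      have hy' : ‖y‖ ≤ 1 := by simpa using (Metric.ball_subset_closedBall hy)
      rw [norm_mul, norm_mul, Real.norm_eq_abs (2 - (n : ℝ)), mul_left_comm]
      gcongr
      exact abs_radialFlux_le (le_of_lt hs) hTx hx.le hy'
    · refine (ae_restrict_iff' measurableSet_ball).2 (Filter.Eventually.of_forall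
        fun y hy s hs => ?_)
      have hy' : ‖y‖ ≤ 1 := by simpa using (Metric.ball_subset_closedBall hy)
      have := (hasDerivAt_bracketSq_rpow
        (bracketSq_pos (hsmall (le_of_lt hs)) hy').ne').const_mul (χ (‖y‖ ^ 2))
      exact this.congr_deriv (by ring)
  have := constant_of_has_deriv_right_zero (a := (0 : ℝ)) (b := 1)
    (fun t ht => (hderiv t ht).continuousAt.continuousWithinAt)
    (fun t ht => (hderiv t ⟨ht.1, ht.2.le⟩).hasDerivWithinAt) 1 (by simp)
  rw [this]
  simp [bracketSq]

/-- Mean value property of the Poisson-type kernel `(1 − |x|²|y|²) / [x,y]^n`. -/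
theorem setIntegral_ball_mul_poisson {n : ℕ} {x : EuclideanSpace ℝ (Fin n)}
    (hx : ‖x‖ < 1) {χ : ℝ → ℝ} (hχ : Continuous χ) :
    ∫ y in Metric.ball (0 : EuclideanSpace ℝ (Fin n)) 1,
      χ (‖y‖ ^ 2) * ((1 - ‖x‖ ^ 2 * ‖y‖ ^ 2) * bracketSq 1 x y ^ (-((n : ℝ) / 2))) =
    ∫ y in Metric.ball (0 : EuclideanSpace ℝ (Fin n)) 1, χ (‖y‖ ^ 2) := by
  have h1 : |(1 : ℝ)| * ‖x‖ < 1 := by simpa using hx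
  have hL := integrable_mul_of_continuousOn_closedBall
    (continuousOn_bracketSq_rpow h1 (1 - (n : ℝ) / 2)) hχ
  have hF := integrable_mul_of_continuousOn_closedBall (continuousOn_radialFlux h1) hχ
  have hsub := integral_sub hL (hF.const_mul 2)
  rw [integral_const_mul, setIntegral_ball_mul_radialFlux_eq_zero h1 hχ, mul_zero, sub_zero,
    setIntegral_ball_mul_bracketSq_rpow hx hχ] at hsub
  rw [← hsub]
  refine setIntegral_congr_fun measurableSet_ball fun y hy => ?_
  have hy' : ‖y‖ ≤ 1 := by simpa using (Metric.ball_subset_closedBall hy)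
  have hpos := bracketSq_pos h1 hy'
  simp only [radialFlux]
  rw [sub_eq_add_neg 1 ((n : ℝ) / 2), Real.rpow_add hpos, Real.rpow_one]
  generalize bracketSq 1 x y ^ (-((n : ℝ) / 2)) = q
  simp only [bracketSq]
  ring

theorem mobiusBracket_pow {n : ℕ} {x y : EuclideanSpace ℝ (Fin n)} (h : 0 ≤ bracketSq 1 x y) :
    mobiusBracket x y ^ n = bracketSq 1 x y ^ ((n : ℝ) / 2) := by
  have : mobiusBracket x y = Real.sqrt (bracketSq 1 x y) := by
    simp [mobiusBracket, bracketSq]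
  rw [this, Real.sqrt_eq_rpow, ← Real.rpow_mul_natCast h]
  congr 1
  ring

theorem setIntegral_ball_second_kernel {n : ℕ} {x : EuclideanSpace ℝ (Fin n)} (hx : ‖x‖ < 1) :
    (∫ y in Metric.ball (0 : EuclideanSpace ℝ (Fin n)) 1,
        ‖y‖ * (1 - ‖x‖ ^ 2) / mobiusBracket x y ^ n) =
      (1 - ‖x‖ ^ 2) * ∫ y in Metric.ball (0 : EuclideanSpace ℝ (Fin n)) 1,
        ‖y‖ / (1 - ‖x‖ ^ 2 * ‖y‖ ^ 2) := by
  have h1 : |(1 : ℝ)| * ‖x‖ < 1 := by simpa using hx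
  have hx2 : ‖x‖ ^ 2 < 1 := pow_lt_one₀ (norm_nonneg x) hx two_ne_zero
  have hden (s : ℝ) : 0 < 1 - ‖x‖ ^ 2 * min s 1 := by
    have : ‖x‖ ^ 2 * min s 1 ≤ ‖x‖ ^ 2 * 1 := by gcongr; exact min_le_right _ _
    linarith
  have hχ : Continuous fun s : ℝ => Real.sqrt s / (1 - ‖x‖ ^ 2 * min s 1) :=
    Continuous.div (by fun_prop) (by fun_prop) fun s => (hden s).ne'
  have key := setIntegral_ball_mul_poisson hx hχ
  have hmin {y : EuclideanSpace ℝ (Fin n)} (hy : y ∈ Metric.ball 0 1) :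
      min (‖y‖ ^ 2) 1 = ‖y‖ ^ 2 :=
    min_eq_left (pow_le_one₀ (norm_nonneg y)
      (by simpa using (Metric.ball_subset_closedBall hy)))
  have hr : ∫ y in Metric.ball (0 : EuclideanSpace ℝ (Fin n)) 1,
        ‖y‖ / (1 - ‖x‖ ^ 2 * ‖y‖ ^ 2) = ∫ y in Metric.ball (0 : EuclideanSpace ℝ (Fin n)) 1,
        Real.sqrt (‖y‖ ^ 2) / (1 - ‖x‖ ^ 2 * min (‖y‖ ^ 2) 1) :=
    setIntegral_congr_fun measurableSet_ball fun y hy => by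
      simp only [hmin hy, Real.sqrt_sq (norm_nonneg y)]
  rw [hr, ← key, ← integral_const_mul]
  refine setIntegral_congr_fun measurableSet_ball fun y hy => ?_
  have hpos := bracketSq_pos h1 (y := y) (by simpa using (Metric.ball_subset_closedBall hy))
  have hd := (hden (‖y‖ ^ 2)).ne'
  simp only [hmin hy] at hd
  simp only [hmin hy, Real.sqrt_sq (norm_nonneg y), mobiusBracket_pow hpos.le,
    Real.rpow_neg hpos.le]
  generalize 1 - ‖x‖ ^ 2 * ‖y‖ ^ 2 = d at hd ⊢
  field_simp

theorem natCast_mul_volume_unitBall {n : ℕ} (hn : n ≠ 0) :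
    n * volume.real (Metric.ball (0 : EuclideanSpace ℝ (Fin n)) 1) =
      2 * π ^ ((n : ℝ) / 2) / Real.Gamma (n / 2) := by
  have : Nonempty (Fin n) := Fin.pos_iff_nonempty.1 (Nat.pos_of_ne_zero hn)
  have hn' : (n : ℝ) / 2 ≠ 0 := by positivity
  have hG : 0 < Real.Gamma ((n : ℝ) / 2) := Real.Gamma_pos_of_pos (by positivity)
  rw [measureReal_def, EuclideanSpace.volume_ball, Fintype.card_fin, Real.Gamma_add_one hn',
    ENNReal.ofReal_one, one_pow, one_mul, ENNReal.toReal_ofReal (by positivity),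
    Real.sqrt_eq_rpow, ← Real.rpow_mul_natCast Real.pi_pos.le,
    show (1 / 2 : ℝ) * n = n / 2 by ring]
  have : (n : ℝ) ≠ 0 := by exact_mod_cast hn
  field_simp

theorem setIntegral_ball_fun_norm {n : ℕ} (hn : n ≠ 0) (f : ℝ → ℝ) :
    ∫ y in Metric.ball (0 : EuclideanSpace ℝ (Fin n)) 1, f ‖y‖ =
      2 * π ^ ((n : ℝ) / 2) / Real.Gamma (n / 2) * ∫ r in (0 : ℝ)..1, r ^ (n - 1) * f r := by
  have : Nonempty (Fin n) := Fin.pos_iff_nonempty.1 (Nat.pos_of_ne_zero hn)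
  rw [← natCast_mul_volume_unitBall hn, ← integral_indicator measurableSet_ball]
  have h1 (y : EuclideanSpace ℝ (Fin n)) :
      (Metric.ball (0 : EuclideanSpace ℝ (Fin n)) 1).indicator (fun y => f ‖y‖) y =
        (Set.Iio (1 : ℝ)).indicator f ‖y‖ := by
    simp [Set.indicator]
  simp_rw [h1]
  rw [integral_fun_norm_addHaar, finrank_euclideanSpace_fin, nsmul_eq_mul, smul_eq_mul, mul_assoc,
    intervalIntegral.integral_of_le zero_le_one, integral_Ioc_eq_integral_Ioo]
  congr 2
  have h2 (r : ℝ) : r ^ (n - 1) • (Set.Iio (1 : ℝ)).indicator f r =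
      (Set.Iio (1 : ℝ)).indicator (fun r => r ^ (n - 1) * f r) r := by
    by_cases h : r < 1 <;> simp [Set.indicator, h]
  simp_rw [h2]
  rw [setIntegral_indicator measurableSet_Iio, Set.Ioi_inter_Iio]

theorem integral_pow_div_one_sub_mul_sq {a : ℝ} (ha0 : 0 ≤ a) (ha1 : a < 1) (n : ℕ) :
    ∫ r in (0 : ℝ)..1, r ^ n / (1 - a * r ^ 2) = ∑' k : ℕ, a ^ k / (n + 1 + 2 * k) := by
  have hterm (k : ℕ) : ∫ r in (0 : ℝ)..1, r ^ n * (a * r ^ 2) ^ k = a ^ k / (n + 1 + 2 * k) := by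
    have : ∀ r : ℝ, r ^ n * (a * r ^ 2) ^ k = a ^ k * r ^ (n + 2 * k) := fun r => by ring
    simp_rw [this]
    rw [intervalIntegral.integral_const_mul, integral_pow]
    push_cast
    simp
    ring
  have hsum := intervalIntegral.hasSum_integral_of_dominated_convergence (μ := volume)
    (a := (0 : ℝ)) (b := 1) (F := fun k r => r ^ n * (a * r ^ 2) ^ k)
    (f := fun r => r ^ n / (1 - a * r ^ 2)) (bound := fun k _ => a ^ k)
    (fun k => Continuous.aestronglyMeasurable (by fun_prop)) (fun k => ?_) ?_ ?_ ?_
  · rw [← hsum.tsum_eq]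
    exact tsum_congr hterm
  · refine Filter.Eventually.of_forall fun r hr => ?_
    rw [Set.uIoc_of_le zero_le_one] at hr
    rw [Real.norm_of_nonneg (by have := hr.1.le; positivity)]
    calc r ^ n * (a * r ^ 2) ^ k ≤ 1 ^ n * (a * 1 ^ 2) ^ k := by
          have := hr.1.le
          have := hr.2
          gcongr
      _ = a ^ k := by simp
  · exact Filter.Eventually.of_forall fun r _ => summable_geometric_of_lt_one ha0 ha1
  · exact intervalIntegrable_const
  · refine Filter.Eventually.of_forall fun r hr => ?_
    rw [Set.uIoc_of_le zero_le_one] at hr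
    have h2 : a * r ^ 2 < 1 := by
      have : r ^ 2 ≤ 1 := pow_le_one₀ hr.1.le hr.2
      nlinarith
    exact (hasSum_geometric_of_lt_one (by positivity) h2).mul_left (r ^ n)

theorem gaussHypergeometric_one_add_one {b : ℝ} (hb : 0 < b) (t : ℝ) :
    gaussHypergeometric 1 b (b + 1) t = ∑' k : ℕ, b / (b + k) * t ^ k := by
  refine tsum_congr fun k => ?_
  have h1 : (ascPochhammer ℝ k).eval 1 = k.factorial := ascPochhammer_eval_one ℝ k
  have h2 : (ascPochhammer ℝ k).eval b * (b + k) = b * (ascPochhammer ℝ k).eval (b + 1) := by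
    rw [← ascPochhammer_succ_eval, ascPochhammer_succ_left]
    simp
  have h3 : (ascPochhammer ℝ k).eval (b + 1) ≠ 0 := (ascPochhammer_pos k _ (by linarith)).ne'
  have h4 : (k.factorial : ℝ) ≠ 0 := by positivity
  have h5 : b + k ≠ 0 := by positivity
  rw [h1]
  congr 1
  field_simp
  linarith

theorem one_sub_mul_gaussHypergeometric_le {b t : ℝ} (hb : 0 < b) (ht0 : 0 ≤ t) (ht1 : t < 1) :
    (1 - t) * gaussHypergeometric 1 b (b + 1) t ≤ 1 := by
  have hg := summable_geometric_of_lt_one ht0 ht1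
  have hle (k : ℕ) : b / (b + k) * t ^ k ≤ t ^ k :=
    mul_le_of_le_one_left (by positivity) (div_le_one_of_le₀ (by simp) (by positivity))
  have hs : Summable fun k : ℕ => b / (b + k) * t ^ k :=
    hg.of_nonneg_of_le (fun k => by positivity) hle
  have := hs.tsum_le_tsum hle hg
  rw [tsum_geometric_of_lt_one ht0 ht1, ← gaussHypergeometric_one_add_one hb] at this
  calc (1 - t) * gaussHypergeometric 1 b (b + 1) t ≤ (1 - t) * (1 - t)⁻¹ :=
        mul_le_mul_of_nonneg_left this (by linarith)
    _ = 1 := mul_inv_cancel₀ (by linarith)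

/-- For `x` in the unit ball,
`∫_{B^n} |y|(1−|x|²)/[x,y]^n dy = (ω_{n−1}/(n+1))(1−|x|²) F(1,(n+1)/2;(n+3)/2;|x|²)`,
this is at most `ω_{n−1}/(n+1) = ∫_{B^n} |y| dy`, with equality when `x = 0`. -/
theorem integral_ball_second_kernel (n : ℕ) (hn : 2 < n) (x : EuclideanSpace ℝ (Fin n))
    (hx : x ∈ Metric.ball (0 : EuclideanSpace ℝ (Fin n)) 1) :
    (∫ y in Metric.ball (0 : EuclideanSpace ℝ (Fin n)) 1,
        ‖y‖ * (1 - ‖x‖ ^ 2) / mobiusBracket x y ^ n) =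
      (2 * π ^ ((n : ℝ) / 2) / Real.Gamma (n / 2)) / (n + 1) * (1 - ‖x‖ ^ 2) *
        gaussHypergeometric 1 ((n + 1) / 2) ((n + 3) / 2) (‖x‖ ^ 2) ∧
    (∫ y in Metric.ball (0 : EuclideanSpace ℝ (Fin n)) 1,
        ‖y‖ * (1 - ‖x‖ ^ 2) / mobiusBracket x y ^ n) ≤
      (2 * π ^ ((n : ℝ) / 2) / Real.Gamma (n / 2)) / (n + 1) ∧
    (∫ y in Metric.ball (0 : EuclideanSpace ℝ (Fin n)) 1, ‖y‖) =
      (2 * π ^ ((n : ℝ) / 2) / Real.Gamma (n / 2)) / (n + 1) ∧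
    (x = 0 →
      (∫ y in Metric.ball (0 : EuclideanSpace ℝ (Fin n)) 1,
          ‖y‖ * (1 - ‖x‖ ^ 2) / mobiusBracket x y ^ n) =
        (2 * π ^ ((n : ℝ) / 2) / Real.Gamma (n / 2)) / (n + 1)) := by
  have hx1 : ‖x‖ < 1 := by simpa using hx
  have hn0 : n ≠ 0 := by omega
  have ha0 : 0 ≤ ‖x‖ ^ 2 := by positivity
  have ha1 : ‖x‖ ^ 2 < 1 := pow_lt_one₀ (norm_nonneg x) hx1 two_ne_zero
  set ω : ℝ := 2 * π ^ ((n : ℝ) / 2) / Real.Gamma (n / 2) with hω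
  have hω0 : 0 ≤ ω := by
    have := Real.Gamma_pos_of_pos (s := (n : ℝ) / 2) (by positivity)
    positivity
  have hb : (0 : ℝ) < (n + 1) / 2 := by positivity
  have hbc : ((n : ℝ) + 3) / 2 = (n + 1) / 2 + 1 := by ring
  have hpow (r : ℝ) : r ^ (n - 1) * r = r ^ n := pow_sub_one_mul hn0 r
  have hmain : (∫ y in Metric.ball (0 : EuclideanSpace ℝ (Fin n)) 1,
        ‖y‖ * (1 - ‖x‖ ^ 2) / mobiusBracket x y ^ n) =
      ω / (n + 1) * (1 - ‖x‖ ^ 2) *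
        gaussHypergeometric 1 ((n + 1) / 2) ((n + 3) / 2) (‖x‖ ^ 2) := by
    rw [setIntegral_ball_second_kernel hx1, hbc, gaussHypergeometric_one_add_one hb,
      setIntegral_ball_fun_norm hn0 fun r => r / (1 - ‖x‖ ^ 2 * r ^ 2)]
    simp_rw [← mul_div_assoc, hpow]
    rw [integral_pow_div_one_sub_mul_sq ha0 ha1]
    have : ∑' k : ℕ, ((n : ℝ) + 1) / 2 / ((n + 1) / 2 + k) * (‖x‖ ^ 2) ^ k =
        ((n : ℝ) + 1) * ∑' k : ℕ, (‖x‖ ^ 2) ^ k / ((n : ℝ) + 1 + 2 * k) := by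
      rw [← tsum_mul_left]
      refine tsum_congr fun k => ?_
      have : (n : ℝ) + 1 + 2 * k ≠ 0 := by positivity
      field_simp
    rw [this, ← hω]
    field_simp
  have hnorm : (∫ y in Metric.ball (0 : EuclideanSpace ℝ (Fin n)) 1, ‖y‖) = ω / (n + 1) := by
    rw [setIntegral_ball_fun_norm hn0 fun r => r]
    simp_rw [hpow]
    rw [integral_pow]
    simp [hω, div_eq_mul_inv]
  refine ⟨hmain, ?_, hnorm, ?_⟩
  · rw [hmain, hbc, mul_assoc]
    exact mul_le_of_le_one_right (by positivity)
      (one_sub_mul_gaussHypergeometric_le hb ha0 ha1)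
  · rintro rfl
    rw [← hnorm]
    simp [mobiusBracket]
end

section
/- Let n > 2 be an integer. Then sup_{x∈B^n} ∫_{B^n} |x−y|^{1−n} ( 1 − (|x−y|/[x,y])^n ) dy = n ω_{n−1}/(n+1), and the supremum is attained at x = 0, where it equals ∫_{B^n} |y|^{1−n}(1 − |y|^n) dy. -/
open Real MeasureTheory
open scoped RealInnerProductSpace

open Set in
/-- Bathtub principle: if `f ≤ c` on `A \ B` and `c ≤ f` on `B \ A`, and `μ A ≤ μ B`, then the
integral of `f` over `A` is at most the one over `B`. -/
theorem setLIntegral_le_of_measure_le {α : Type*} [MeasurableSpace α] {μ : Measure α}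
    {f : α → ENNReal} {A B : Set α} {c : ENNReal} (hA : MeasurableSet A) (hB : MeasurableSet B)
    (hfin : μ (A ∩ B) ≠ ⊤) (hAB : μ A ≤ μ B) (hf_le : ∀ a ∈ A \ B, f a ≤ c)
    (hf_ge : ∀ a ∈ B \ A, c ≤ f a) :
    ∫⁻ a in A, f a ∂μ ≤ ∫⁻ a in B, f a ∂μ := by
  have hdiff : μ (A \ B) ≤ μ (B \ A) := by
    rw [← measure_inter_add_sdiff A hB, ← measure_inter_add_sdiff B hA, inter_comm B A] at hAB
    exact (ENNReal.add_le_add_iff_left hfin).1 hAB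
  rw [← lintegral_inter_add_sdiff f A hB, ← lintegral_inter_add_sdiff f B hA, inter_comm B A]
  gcongr 1
  calc ∫⁻ a in A \ B, f a ∂μ ≤ ∫⁻ _ in A \ B, c ∂μ := setLIntegral_mono' (hA.diff hB) hf_le
    _ = c * μ (A \ B) := setLIntegral_const _ _
    _ ≤ c * μ (B \ A) := by gcongr
    _ = ∫⁻ _ in B \ A, c ∂μ := (setLIntegral_const _ _).symm
    _ ≤ ∫⁻ a in B \ A, f a ∂μ := setLIntegral_mono' (hB.diff hA) hf_ge

open Set in
theorem ofReal_one_sub_pow_eq_lintegral {n : ℕ} (hn : 0 < n) {w : ℝ} (hw0 : 0 ≤ w) (hw1 : w ≤ 1) :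
    ENNReal.ofReal (1 - w ^ n) =
      ∫⁻ u in Ioc (0 : ℝ) 1, (Ioi w).indicator (fun u => ENNReal.ofReal (n * u ^ (n - 1))) u := by
  have hint : ∫ u in w..1, (n : ℝ) * u ^ (n - 1) = 1 - w ^ n := by
    have hn' : (n : ℝ) ≠ 0 := by positivity
    obtain ⟨m, rfl⟩ := Nat.exists_eq_succ_of_ne_zero hn.ne'
    rw [intervalIntegral.integral_const_mul]
    simp only [Nat.succ_eq_add_one, Nat.add_sub_cancel, integral_pow]
    push_cast at hn' ⊢
    field_simp
    simp
  rw [lintegral_indicator measurableSet_Ioi, Measure.restrict_restrict measurableSet_Ioi,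
    inter_comm, Ioc_inter_Ioi, max_eq_right hw0, ← hint, intervalIntegral.integral_of_le hw1]
  refine ofReal_integral_eq_lintegral_ofReal ?_ ?_
  · exact (Continuous.integrableOn_Icc (by fun_prop)).mono_set Ioc_subset_Icc_self
  · filter_upwards [ae_restrict_mem measurableSet_Ioc] with u hu
    have : 0 ≤ u := hw0.trans hu.1.le
    positivity

open Set in
theorem setLIntegral_mul_one_sub_pow {α : Type*} [MeasurableSpace α] {μ : Measure α} [SFinite μ]
    {n : ℕ} (hn : 0 < n) {s : Set α} (hs : MeasurableSet s) {g : α → ENNReal} (hg : Measurable g)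
    {w : α → ℝ} (hw : Measurable w) (hw0 : ∀ a ∈ s, 0 ≤ w a) (hw1 : ∀ a ∈ s, w a ≤ 1) :
    ∫⁻ a in s, g a * ENNReal.ofReal (1 - w a ^ n) ∂μ =
      ∫⁻ u in Ioc (0 : ℝ) 1, ENNReal.ofReal (n * u ^ (n - 1)) *
        ∫⁻ a in {a | w a < u} ∩ s, g a ∂μ := by
  have hmeas : Measurable fun p : α × ℝ =>
      g p.1 * {p : α × ℝ | w p.1 < p.2}.indicator
        (fun p => ENNReal.ofReal (n * p.2 ^ (n - 1))) p := by
    refine (hg.comp measurable_fst).mul (Measurable.indicator (by fun_prop) ?_)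
    exact measurableSet_lt (hw.comp measurable_fst) measurable_snd
  calc ∫⁻ a in s, g a * ENNReal.ofReal (1 - w a ^ n) ∂μ
      = ∫⁻ a in s, (∫⁻ u in Ioc (0 : ℝ) 1, g a * {p : α × ℝ | w p.1 < p.2}.indicator
          (fun p => ENNReal.ofReal (n * p.2 ^ (n - 1))) (a, u)) ∂μ := by
        refine setLIntegral_congr_fun hs fun a ha => ?_
        rw [lintegral_const_mul, ofReal_one_sub_pow_eq_lintegral hn (hw0 a ha) (hw1 a ha)]
        · rfl
        · refine Measurable.indicator (f := fun u : ℝ => ENNReal.ofReal (n * u ^ (n - 1)))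
            (by fun_prop) (measurableSet_Ioi (a := w a))
    _ = ∫⁻ u in Ioc (0 : ℝ) 1, ∫⁻ a in s, g a * {p : α × ℝ | w p.1 < p.2}.indicator
          (fun p => ENNReal.ofReal (n * p.2 ^ (n - 1))) (a, u) ∂μ :=
        lintegral_lintegral_swap hmeas.aemeasurable
    _ = _ := by
        refine lintegral_congr fun u => ?_
        have hu : MeasurableSet {a | w a < u} := measurableSet_lt hw measurable_const
        rw [← Measure.restrict_restrict hu, ← lintegral_const_mul _ hg, ← lintegral_indicator hu]
        refine lintegral_congr fun a => ?_
        by_cases h : w a < u <;> simp [indicator, h, mul_comm]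

theorem mobiusBracket_sq_eq {n : ℕ} (x y : EuclideanSpace ℝ (Fin n)) :
    ‖x‖ ^ 2 * ‖y‖ ^ 2 - 2 * ⟪x, y⟫ + 1 = ‖x - y‖ ^ 2 + (1 - ‖x‖ ^ 2) * (1 - ‖y‖ ^ 2) := by
  rw [norm_sub_sq_real]
  ring

theorem mobiusBracket_zero_left {n : ℕ} (y : EuclideanSpace ℝ (Fin n)) :
    mobiusBracket 0 y = 1 := by
  simp [mobiusBracket]

theorem measurable_mobiusBracket {n : ℕ} (x : EuclideanSpace ℝ (Fin n)) :
    Measurable (mobiusBracket x) := by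
  unfold mobiusBracket
  fun_prop

section UnitBall

variable {n : ℕ} {x y : EuclideanSpace ℝ (Fin n)}

theorem one_sub_norm_sq_pos (hx : ‖x‖ < 1) : 0 < 1 - ‖x‖ ^ 2 := by
  nlinarith [norm_nonneg x]

theorem mobiusBracket_sq (hx : ‖x‖ < 1) (hy : ‖y‖ < 1) :
    mobiusBracket x y ^ 2 = ‖x - y‖ ^ 2 + (1 - ‖x‖ ^ 2) * (1 - ‖y‖ ^ 2) := by
  have := mul_pos (one_sub_norm_sq_pos hx) (one_sub_norm_sq_pos hy)
  rw [mobiusBracket, mobiusBracket_sq_eq, Real.sq_sqrt (by positivity)]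

theorem mobiusBracket_pos (hx : ‖x‖ < 1) (hy : ‖y‖ < 1) : 0 < mobiusBracket x y := by
  have := mul_pos (one_sub_norm_sq_pos hx) (one_sub_norm_sq_pos hy)
  rw [mobiusBracket, mobiusBracket_sq_eq]
  positivity

theorem norm_sub_div_mobiusBracket_le_one (hx : ‖x‖ < 1) (hy : ‖y‖ < 1) :
    ‖x - y‖ / mobiusBracket x y ≤ 1 := by
  have := mul_pos (one_sub_norm_sq_pos hx) (one_sub_norm_sq_pos hy)
  rw [div_le_one (mobiusBracket_pos hx hy), ← abs_of_pos (mobiusBracket_pos hx hy),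
    ← abs_of_nonneg (norm_nonneg (x - y)), ← sq_le_sq, mobiusBracket_sq hx hy]
  linarith

/-- A pseudohyperbolic ball of radius `u` is contained in a Euclidean ball of radius at most `u`. -/
theorem mem_ball_of_norm_sub_div_mobiusBracket_lt {u : ℝ} (hu0 : 0 < u) (hu1 : u ≤ 1)
    (hx : ‖x‖ < 1) (hy : ‖y‖ < 1) (h : ‖x - y‖ / mobiusBracket x y < u) :
    y ∈ Metric.ball (((1 - u ^ 2) / (1 - u ^ 2 * ‖x‖ ^ 2)) • x) u := by
  have hr := one_sub_norm_sq_pos hx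
  have hu2 : u ^ 2 ≤ 1 := by nlinarith
  have hD : 0 < 1 - u ^ 2 * ‖x‖ ^ 2 := by nlinarith [sq_nonneg ‖x‖]
  have hsq : ‖x - y‖ ^ 2 < u ^ 2 * mobiusBracket x y ^ 2 := by
    rw [div_lt_iff₀ (mobiusBracket_pos hx hy)] at h
    rw [← mul_pow]
    gcongr
  rw [mobiusBracket_sq hx hy, ← mobiusBracket_sq_eq, norm_sub_sq_real] at hsq
  have hkey : ‖y - ((1 - u ^ 2) / (1 - u ^ 2 * ‖x‖ ^ 2)) • x‖ ^ 2 <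
      (u * (1 - ‖x‖ ^ 2) / (1 - u ^ 2 * ‖x‖ ^ 2)) ^ 2 := by
    rw [norm_sub_sq_real, inner_smul_right, norm_smul, mul_pow, Real.norm_eq_abs, sq_abs,
      real_inner_comm, div_pow, div_pow, ← sub_pos]
    have : (u * (1 - ‖x‖ ^ 2)) ^ 2 / (1 - u ^ 2 * ‖x‖ ^ 2) ^ 2 -
        (‖y‖ ^ 2 - 2 * ((1 - u ^ 2) / (1 - u ^ 2 * ‖x‖ ^ 2) * ⟪x, y⟫) +
          (1 - u ^ 2) ^ 2 / (1 - u ^ 2 * ‖x‖ ^ 2) ^ 2 * ‖x‖ ^ 2) =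
        (u ^ 2 * (‖x‖ ^ 2 * ‖y‖ ^ 2 - 2 * ⟪x, y⟫ + 1) - (‖x‖ ^ 2 - 2 * ⟪x, y⟫ + ‖y‖ ^ 2)) /
          (1 - u ^ 2 * ‖x‖ ^ 2) := by
      field_simp
      ring
    rw [this]
    exact div_pos (sub_pos.2 hsq) hD
  rw [mem_ball_iff_norm]
  refine (lt_of_pow_lt_pow_left₀ 2 (by positivity) hkey).trans_le ?_
  rw [div_le_iff₀ hD]
  gcongr
  nlinarith [sq_nonneg ‖x‖]

open Metric in
theorem setLIntegral_pseudohyperbolic_le (hn : 0 < n) {u : ℝ} (hu0 : 0 < u) (hu1 : u ≤ 1)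
    (hx : ‖x‖ < 1) :
    ∫⁻ y in {y | ‖x - y‖ / mobiusBracket x y < u} ∩ ball 0 1,
        ENNReal.ofReal (‖x - y‖ ^ ((1 : ℝ) - n)) ≤
      ∫⁻ y in {y : EuclideanSpace ℝ (Fin n) | ‖y‖ < u} ∩ ball 0 1,
        ENNReal.ofReal (‖y‖ ^ ((1 : ℝ) - n)) := by
  have hexp : (1 : ℝ) - n ≤ 0 := by
    have : (1 : ℝ) ≤ n := by exact_mod_cast hn
    linarith
  have hball : {y : EuclideanSpace ℝ (Fin n) | ‖y‖ < u} ∩ ball 0 1 = ball 0 u := by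
    ext y
    simp only [Set.mem_inter_iff, Set.mem_ofPred_eq, mem_ball_zero_iff, and_iff_left_iff_imp]
    exact fun h => h.trans_le hu1
  have hmeas : MeasurableSet ({y | ‖x - y‖ / mobiusBracket x y < u} ∩ ball 0 1) :=
    (measurableSet_lt ((by fun_prop : Measurable fun y => ‖x - y‖).div
      (measurable_mobiusBracket x)) measurable_const).inter measurableSet_ball
  have hpre : (fun y => x - y) ⁻¹' ball 0 u = ball x u := by
    ext y
    simp [dist_eq_norm, norm_sub_rev]
  rw [hball, ← (volume.measurePreserving_sub_left x).setLIntegral_comp_preimage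
    measurableSet_ball (by fun_prop), hpre]
  refine setLIntegral_le_of_measure_le (c := ENNReal.ofReal (u ^ ((1 : ℝ) - n))) hmeas
    measurableSet_ball ?_ ?_ ?_ ?_
  · exact ((measure_mono Set.inter_subset_right).trans_lt measure_ball_lt_top).ne
  · refine (measure_mono (t := ball (((1 - u ^ 2) / (1 - u ^ 2 * ‖x‖ ^ 2)) • x) u) ?_).trans_eq ?_
    · intro y hy
      exact mem_ball_of_norm_sub_div_mobiusBracket_lt hu0 hu1 hx (mem_ball_zero_iff.1 hy.2) hy.1
    · rw [Measure.addHaar_ball_center, Measure.addHaar_ball_center volume x]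
  · intro y hy
    have h : u ≤ ‖x - y‖ := by
      simpa [dist_eq_norm, norm_sub_rev] using hy.2
    exact ENNReal.ofReal_le_ofReal (Real.rpow_le_rpow_of_nonpos hu0 h hexp)
  · intro y hy
    have h : ‖x - y‖ < u := by
      simpa [dist_eq_norm, norm_sub_rev] using hy.1
    have hne : 0 < ‖x - y‖ := by
      rw [norm_pos_iff, sub_ne_zero]
      rintro rfl
      exact hy.2 ⟨by simpa using hu0, by simpa using hx⟩
    exact ENNReal.ofReal_le_ofReal (Real.rpow_le_rpow_of_nonpos hne h.le hexp)

open Metric in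
theorem setLIntegral_kernel_le (hn : 0 < n) (hx : ‖x‖ < 1) :
    ∫⁻ y in ball 0 1, ENNReal.ofReal
        (‖x - y‖ ^ ((1 : ℝ) - n) * (1 - (‖x - y‖ / mobiusBracket x y) ^ n)) ≤
      ∫⁻ y in ball (0 : EuclideanSpace ℝ (Fin n)) 1,
        ENNReal.ofReal (‖y‖ ^ ((1 : ℝ) - n) * (1 - ‖y‖ ^ n)) := by
  have hw (y : EuclideanSpace ℝ (Fin n)) (hy : y ∈ ball (0 : EuclideanSpace ℝ (Fin n)) 1) :
      0 ≤ ‖x - y‖ / mobiusBracket x y :=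
    div_nonneg (norm_nonneg _) (mobiusBracket_pos hx (mem_ball_zero_iff.1 hy)).le
  simp_rw [ENNReal.ofReal_mul (Real.rpow_nonneg (norm_nonneg _) _)]
  rw [setLIntegral_mul_one_sub_pow hn measurableSet_ball (by fun_prop)
      (w := fun y => ‖x - y‖ / mobiusBracket x y)
      ((by fun_prop : Measurable fun y => ‖x - y‖).div (measurable_mobiusBracket x)) hw
      fun y hy => norm_sub_div_mobiusBracket_le_one hx (mem_ball_zero_iff.1 hy),
    setLIntegral_mul_one_sub_pow hn measurableSet_ball (by fun_prop) measurable_norm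
      (fun _ _ => norm_nonneg _) fun y hy => (mem_ball_zero_iff.1 hy).le]
  refine setLIntegral_mono' measurableSet_Ioc fun u hu => ?_
  gcongr 1
  exact setLIntegral_pseudohyperbolic_le hn hu.1 hu.2 hx

end UnitBall

open Metric Set in
theorem integral_ball_norm_rpow_mul_one_sub_pow {n : ℕ} (hn : 0 < n) :
    ∫ y in ball (0 : EuclideanSpace ℝ (Fin n)) 1, ‖y‖ ^ ((1 : ℝ) - n) * (1 - ‖y‖ ^ n) =
      n * (2 * π ^ ((n : ℝ) / 2) / Real.Gamma (n / 2)) / (n + 1) := by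
  have : Nonempty (Fin n) := Fin.pos_iff_nonempty.1 hn
  have hn0 : (0 : ℝ) < n := by exact_mod_cast hn
  have hind : (ball (0 : EuclideanSpace ℝ (Fin n)) 1).indicator
      (fun y => ‖y‖ ^ ((1 : ℝ) - n) * (1 - ‖y‖ ^ n)) =
      fun y => (Iio (1 : ℝ)).indicator (fun t => t ^ ((1 : ℝ) - n) * (1 - t ^ n)) ‖y‖ := by
    ext y
    simp [indicator]
  have hradial : ∫ t in Ioi (0 : ℝ), t ^ (n - 1) •
      (Iio (1 : ℝ)).indicator (fun t => t ^ ((1 : ℝ) - n) * (1 - t ^ n)) t = n / (n + 1) := by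
    calc _ = ∫ t in Ioi (0 : ℝ), (Iio (1 : ℝ)).indicator (fun t => 1 - t ^ n) t := by
          refine setIntegral_congr_fun measurableSet_Ioi fun t ht => ?_
          have ht : 0 < t := ht
          by_cases h : t < 1
          · simp only [indicator, mem_Iio, h, if_true, smul_eq_mul]
            rw [← mul_assoc, ← Real.rpow_natCast, ← Real.rpow_add ht, Nat.cast_pred hn]
            simp
          · simp [indicator, h]
      _ = ∫ t in (0 : ℝ)..1, (1 - t ^ n) := by
          rw [setIntegral_indicator measurableSet_Iio, Ioi_inter_Iio,
            intervalIntegral.integral_of_le zero_le_one, integral_Ioc_eq_integral_Ioo]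
      _ = n / (n + 1) := by
          rw [intervalIntegral.integral_sub (by simp) (by simp)]
          simp
          field_simp
          ring
  have hvol : volume.real (ball (0 : EuclideanSpace ℝ (Fin n)) 1) =
      √π ^ n / Real.Gamma (n / 2 + 1) := by
    rw [Measure.real, EuclideanSpace.volume_ball]
    have : 0 < Real.Gamma ((n : ℝ) / 2 + 1) := Real.Gamma_pos_of_pos (by positivity)
    simp only [ENNReal.ofReal_one, one_pow, one_mul, Fintype.card_fin]
    exact ENNReal.toReal_ofReal (by positivity)
  have hpi : √π ^ n = π ^ ((n : ℝ) / 2) := by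
    rw [Real.sqrt_eq_rpow, ← Real.rpow_natCast, ← Real.rpow_mul Real.pi_pos.le]
    ring_nf
  have hGamma : 0 < Real.Gamma ((n : ℝ) / 2) := Real.Gamma_pos_of_pos (by positivity)
  rw [← integral_indicator measurableSet_ball, hind, integral_fun_norm_addHaar, finrank_euclideanSpace,
    Fintype.card_fin, hradial, hvol, hpi, Real.Gamma_add_one (by positivity)]
  simp only [nsmul_eq_mul, smul_eq_mul]
  field_simp

/-- `sup_{x∈B^n} ∫_{B^n} |x−y|^{1−n}(1 − (|x−y|/[x,y])^n) dy = n ω_{n−1}/(n+1)`, attained at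
`x = 0`, where it equals `∫_{B^n} |y|^{1−n}(1 − |y|^n) dy`. -/
theorem sup_integral_first_kernel (n : ℕ) (hn : 2 < n) :
    IsGreatest
      ((fun x => ∫ y in Metric.ball (0 : EuclideanSpace ℝ (Fin n)) 1,
          ‖x - y‖ ^ ((1 : ℝ) - n) * (1 - (‖x - y‖ / mobiusBracket x y) ^ n)) ''
        Metric.ball (0 : EuclideanSpace ℝ (Fin n)) 1)
      (n * (2 * π ^ ((n : ℝ) / 2) / Real.Gamma (n / 2)) / (n + 1)) ∧
    (∫ y in Metric.ball (0 : EuclideanSpace ℝ (Fin n)) 1,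
        ‖(0 : EuclideanSpace ℝ (Fin n)) - y‖ ^ ((1 : ℝ) - n) *
          (1 - (‖(0 : EuclideanSpace ℝ (Fin n)) - y‖ / mobiusBracket 0 y) ^ n)) =
      n * (2 * π ^ ((n : ℝ) / 2) / Real.Gamma (n / 2)) / (n + 1) ∧
    (∫ y in Metric.ball (0 : EuclideanSpace ℝ (Fin n)) 1,
        ‖y‖ ^ ((1 : ℝ) - n) * (1 - ‖y‖ ^ n)) =
      n * (2 * π ^ ((n : ℝ) / 2) / Real.Gamma (n / 2)) / (n + 1) := by
  have hn0 : 0 < n := by lia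
  have hval := integral_ball_norm_rpow_mul_one_sub_pow hn0
  have hzero : (∫ y in Metric.ball (0 : EuclideanSpace ℝ (Fin n)) 1,
        ‖(0 : EuclideanSpace ℝ (Fin n)) - y‖ ^ ((1 : ℝ) - n) *
          (1 - (‖(0 : EuclideanSpace ℝ (Fin n)) - y‖ / mobiusBracket 0 y) ^ n)) =
      n * (2 * π ^ ((n : ℝ) / 2) / Real.Gamma (n / 2)) / (n + 1) := by
    simpa only [mobiusBracket_zero_left, zero_sub, norm_neg, div_one] using hval
  have hpos : 0 < n * (2 * π ^ ((n : ℝ) / 2) / Real.Gamma (n / 2)) / (n + 1) := by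
    have := Real.Gamma_pos_of_pos (by positivity : 0 < (n : ℝ) / 2)
    positivity
  refine ⟨⟨⟨0, by simp, hzero⟩, ?_⟩, hzero, hval⟩
  rintro _ ⟨x, hx, rfl⟩
  rw [mem_ball_zero_iff] at hx
  have hint := Integrable.of_integral_ne_zero (hval.trans_ne hpos.ne')
  simp only
  rw [integral_eq_lintegral_of_nonneg_ae]
  · refine ENNReal.toReal_le_of_le_ofReal hpos.le ((setLIntegral_kernel_le hn0 hx).trans_eq ?_)
    rw [← hval, ofReal_integral_eq_lintegral_ofReal hint]
    filter_upwards [ae_restrict_mem measurableSet_ball] with y hy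
    have : ‖y‖ ^ n ≤ 1 := pow_le_one₀ (norm_nonneg y) (mem_ball_zero_iff.1 hy).le
    exact mul_nonneg (by positivity) (sub_nonneg.2 this)
  · filter_upwards [ae_restrict_mem measurableSet_ball] with y hy
    rw [mem_ball_zero_iff] at hy
    have := pow_le_one₀ (n := n) (div_nonneg (norm_nonneg (x - y)) (mobiusBracket_pos hx hy).le)
      (norm_sub_div_mobiusBracket_le_one hx hy)
    exact mul_nonneg (by positivity) (sub_nonneg.2 this)
  · have := measurable_mobiusBracket x
    exact Measurable.aestronglyMeasurable (by fun_prop)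
end
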